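/- arXiv:1603.03426 — 3 statements merged into one kernel-verified Lean document; each statement's English description precedes it below -/
import Mathlib

section
/- Let p ∈ (1,∞) with conjugate exponent q, let h ∈ H^p(ℝ) and let φ ∈ L^q(ℝ) vanish a.e. on (−∞,0). Then the kernel k(x)(y) = h(x)φ(x−y) belongs to L^p(ℝ;L^q(ℝ)), the operator Int k equals M_h Δ_φ (multiplication by h composed with convolution by φ), and Int k lies in G^p ∩ A_par^p. -/
open MeasureTheory Complex Filter Topology
open scoped ENNReal NNReal

noncomputable section

/-- `L^p(ℝ)` with complex values. -/
abbrev LpR (p : ℝ≥0∞) := MeasureTheory.Lp ℂ p (volume : Measure ℝ)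

/-- The Bochner space `L^p(ℝ; L^q(ℝ))`. -/
abbrev LpLq (p q : ℝ≥0∞) [Fact (1 ≤ q)] := MeasureTheory.Lp (LpR q) p (volume : Measure ℝ)

/-- `T` is the operator of multiplication by `φ`. -/
def IsMulOp (p : ℝ≥0∞) [Fact (1 ≤ p)] (φ : ℝ → ℂ) (T : LpR p →L[ℂ] LpR p) : Prop :=
  ∀ f : LpR p, (T f : ℝ → ℂ) =ᵐ[volume] fun x => φ x * (f : ℝ → ℂ) x

/-- `T` is the operator of translation by `μ`: `(T f)(x) = f (x - μ)`. -/
def IsTransOp (p : ℝ≥0∞) [Fact (1 ≤ p)] (μ : ℝ) (T : LpR p →L[ℂ] LpR p) : Prop :=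
  ∀ f : LpR p, (T f : ℝ → ℂ) =ᵐ[volume] fun x => (f : ℝ → ℂ) (x - μ)

/-- A set of operators is closed in the strong operator topology (the topology of
pointwise norm convergence) if it contains every operator which is an SOT-limit point. -/
def IsSOTClosed (p : ℝ≥0∞) [Fact (1 ≤ p)] (S : Set (LpR p →L[ℂ] LpR p)) : Prop :=
  ∀ T : LpR p →L[ℂ] LpR p,
    (⇑T ∈ closure ((fun A : LpR p →L[ℂ] LpR p => (A : LpR p → LpR p)) '' S)) → T ∈ S

/-- The generators of the parabolic algebra: multiplications `M_λ`, `λ ≥ 0`, and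
translations `D_μ`, `μ ≥ 0`. -/
def parabolicGens (p : ℝ≥0∞) [Fact (1 ≤ p)] : Set (LpR p →L[ℂ] LpR p) :=
  {T | ∃ l : ℝ, 0 ≤ l ∧ IsMulOp p (fun x => Complex.exp (Complex.I * l * x)) T} ∪
  {T | ∃ m : ℝ, 0 ≤ m ∧ IsTransOp p m T}

/-- The parabolic algebra: the smallest SOT-closed subalgebra of `B(L^p(ℝ))` containing
the multiplication semigroup and the translation semigroup. -/
def parabolicAlgebra (p : ℝ≥0∞) [Fact (1 ≤ p)] : Set (LpR p →L[ℂ] LpR p) :=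
  ⋂₀ {S | parabolicGens p ⊆ S ∧ IsSOTClosed p S ∧
      ∃ A : Subalgebra ℂ (LpR p →L[ℂ] LpR p), (A : Set (LpR p →L[ℂ] LpR p)) = S}

/-- The Hardy space `H^p(ℝ)`, as a subset of `L^p(ℝ)`. -/
def hardy (p : ℝ≥0∞) [Fact (1 ≤ p)] : Set (LpR p) :=
  {f | ∀ u : ℂ, 0 < u.im → ∫ x : ℝ, (f : ℝ → ℂ) x / ((x : ℂ) + u) = 0}

/-- `L^p[t,∞)`, the subspace of functions vanishing a.e. on `(-∞, t)`. -/
def LpHalfLine (p : ℝ≥0∞) [Fact (1 ≤ p)] (t : ℝ) : Set (LpR p) :=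
  {f | ∀ᵐ x : ℝ, x < t → (f : ℝ → ℂ) x = 0}

/-- The image of the Hardy space under multiplication by the function `φ`. -/
def mulHardy (p : ℝ≥0∞) [Fact (1 ≤ p)] (φ : ℝ → ℂ) : Set (LpR p) :=
  {g | ∃ f ∈ hardy p, (g : ℝ → ℂ) =ᵐ[volume] fun x => φ x * (f : ℝ → ℂ) x}

/-- The Fourier binest algebra: operators leaving invariant each `L^p[t,∞)` and each
`e^{iλx}H^p(ℝ)`. -/
def fourierBinest (p : ℝ≥0∞) [Fact (1 ≤ p)] : Set (LpR p →L[ℂ] LpR p) :=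
  {T | (∀ t : ℝ, ∀ f ∈ LpHalfLine p t, T f ∈ LpHalfLine p t) ∧
       (∀ l : ℝ, ∀ f ∈ mulHardy p (fun x => Complex.exp (Complex.I * l * x)),
          T f ∈ mulHardy p (fun x => Complex.exp (Complex.I * l * x)))}

/-- `T` is the `(p,q)`-integral operator with kernel `k`. -/
def IsIntOp (p q : ℝ≥0∞) [Fact (1 ≤ p)] [Fact (1 ≤ q)] (k : LpLq p q)
    (T : LpR p →L[ℂ] LpR p) : Prop :=
  ∀ f : LpR p, (T f : ℝ → ℂ) =ᵐ[volume]
    fun x => ∫ y : ℝ, ((k : ℝ → LpR q) x : ℝ → ℂ) y * (f : ℝ → ℂ) y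

/-- `G^p`, the set of `(p,q)`-integral operators on `L^p(ℝ)`. -/
def Gp (p q : ℝ≥0∞) [Fact (1 ≤ p)] [Fact (1 ≤ q)] : Set (LpR p →L[ℂ] LpR p) :=
  {T | ∃ k : LpLq p q, IsIntOp p q k T}

/-- Dominated convergence for pointwise products with a fixed element of `L^p`. -/
theorem tendsto_Lp_of_mul_dominated {p : ℝ≥0∞} [Fact (1 ≤ p)] (hp : p ≠ ⊤) {ι : Type*}
    {l : Filter ι} [l.IsCountablyGenerated] {G : ι → LpR p} {G₀ g : LpR p}
    {c : ι → ℝ → ℂ} {c₀ : ℝ → ℂ} {C : ℝ}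
    (hG : ∀ i, (G i : ℝ → ℂ) =ᵐ[volume] fun x => c i x * (g : ℝ → ℂ) x)
    (hG₀ : (G₀ : ℝ → ℂ) =ᵐ[volume] fun x => c₀ x * (g : ℝ → ℂ) x)
    (hc : ∀ i x, ‖c i x‖ ≤ C) (hc₀ : ∀ x, ‖c₀ x‖ ≤ C)
    (hlim : ∀ x, Tendsto (fun i => c i x) l (𝓝 (c₀ x))) :
    Tendsto G l (𝓝 G₀) := by
  have hp0 : p ≠ 0 := (zero_lt_one.trans_le Fact.out).ne'
  have hpr : 0 < p.toReal := ENNReal.toReal_pos hp0 hp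
  have hsub : ∀ i, (⇑(G i) - ⇑G₀) =ᵐ[volume] fun x => (c i x - c₀ x) * (g : ℝ → ℂ) x := by
    intro i
    filter_upwards [hG i, hG₀] with x h1 h2
    rw [Pi.sub_apply, h1, h2, sub_mul]
  have key : Tendsto (fun i => ∫⁻ x, ‖(c i x - c₀ x) * (g : ℝ → ℂ) x‖ₑ ^ p.toReal) l
      (𝓝 (∫⁻ _ : ℝ, (0 : ℝ≥0∞))) := by
    refine tendsto_lintegral_filter_of_dominated_convergence'
      (fun x => ‖((2 * C : ℝ) : ℂ) * (g : ℝ → ℂ) x‖ₑ ^ p.toReal) ?_ ?_ ?_ ?_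
    · exact .of_forall fun i => ((((Lp.aestronglyMeasurable (G i)).sub
        (Lp.aestronglyMeasurable G₀)).congr (hsub i)).enorm).pow_const _
    · refine .of_forall fun i => .of_forall fun x => ENNReal.rpow_le_rpow ?_ hpr.le
      rw [enorm_mul, enorm_mul]
      gcongr
      rw [enorm_le_iff_norm_le]
      have : ‖c i x - c₀ x‖ ≤ 2 * C := by
        linarith [norm_sub_le (c i x) (c₀ x), hc i x, hc₀ x]
      exact this.trans (by rw [Complex.norm_real]; exact le_abs_self _)
    · exact (lintegral_rpow_enorm_lt_top_of_eLpNorm_lt_top hp0 hp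
        ((Lp.memLp g).const_mul ((2 * C : ℝ) : ℂ)).2).ne
    · refine .of_forall fun x => ?_
      have h1 : Tendsto (fun i => (c i x - c₀ x) * (g : ℝ → ℂ) x) l (𝓝 0) := by
        simpa using ((hlim x).sub_const (c₀ x)).mul_const ((g : ℝ → ℂ) x)
      have h2 := (ENNReal.continuous_rpow_const (y := p.toReal)).tendsto _ |>.comp h1.enorm
      simpa [Function.comp_def, hpr] using h2
  rw [Lp.tendsto_Lp_iff_tendsto_eLpNorm']
  have h3 := (ENNReal.continuous_rpow_const (y := 1 / p.toReal)).tendsto _ |>.comp key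
  simp only [lintegral_zero, one_div, ENNReal.zero_rpow_of_pos (inv_pos.2 hpr)] at h3
  refine h3.congr fun i => ?_
  rw [eLpNorm_congr_ae (hsub i), eLpNorm_eq_lintegral_rpow_enorm_toReal hp0 hp, one_div]
  rfl

/-- The translation operator `f ↦ f (· - s)` on `L^p(ℝ)`. -/
def transOp (p : ℝ≥0∞) [Fact (1 ≤ p)] (s : ℝ) : LpR p →L[ℂ] LpR p :=
  (Lp.compMeasurePreservingₗᵢ ℂ (fun x : ℝ => x - s)
    (measurePreserving_sub_right volume s)).toContinuousLinearMap

theorem isTransOp_transOp (p : ℝ≥0∞) [Fact (1 ≤ p)] (s : ℝ) : IsTransOp p s (transOp p s) :=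
  fun f => Lp.coeFn_compMeasurePreserving f (measurePreserving_sub_right volume s)

theorem norm_transOp_apply (p : ℝ≥0∞) [Fact (1 ≤ p)] (s : ℝ) (f : LpR p) :
    ‖transOp p s f‖ = ‖f‖ :=
  (Lp.compMeasurePreservingₗᵢ ℂ (fun x : ℝ => x - s)
    (measurePreserving_sub_right volume s)).norm_map f

theorem continuous_transOp_apply {p : ℝ≥0∞} [Fact (1 ≤ p)] (hp : p ≠ ⊤) (f : LpR p) :
    Continuous fun s => transOp p s f :=
  Continuous.compMeasurePreservingLp (f := fun _ => f)
    (g := (ContinuousMap.mk (fun z : ℝ × ℝ => z.2 - z.1)).curry)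
    continuous_const (ContinuousMap.continuous _)
    (fun s => measurePreserving_sub_right volume s) hp

/-- The operator `f ↦ f (s - ·)` on `L^p(ℝ)`. -/
def reflOp (p : ℝ≥0∞) [Fact (1 ≤ p)] (s : ℝ) : LpR p →L[ℂ] LpR p :=
  (Lp.compMeasurePreservingₗᵢ ℂ (fun x : ℝ => s - x)
    (Measure.measurePreserving_sub_left volume s)).toContinuousLinearMap

theorem coeFn_reflOp (p : ℝ≥0∞) [Fact (1 ≤ p)] (s : ℝ) (f : LpR p) :
    (reflOp p s f : ℝ → ℂ) =ᵐ[volume] fun x => (f : ℝ → ℂ) (s - x) :=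
  Lp.coeFn_compMeasurePreserving f (Measure.measurePreserving_sub_left volume s)

theorem norm_reflOp_apply (p : ℝ≥0∞) [Fact (1 ≤ p)] (s : ℝ) (f : LpR p) :
    ‖reflOp p s f‖ = ‖f‖ :=
  (Lp.compMeasurePreservingₗᵢ ℂ (fun x : ℝ => s - x)
    (Measure.measurePreserving_sub_left volume s)).norm_map f

theorem continuous_reflOp_apply {p : ℝ≥0∞} [Fact (1 ≤ p)] (hp : p ≠ ⊤) (f : LpR p) :
    Continuous fun s => reflOp p s f :=
  Continuous.compMeasurePreservingLp (f := fun _ => f)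
    (g := (ContinuousMap.mk (fun z : ℝ × ℝ => z.1 - z.2)).curry)
    continuous_const (ContinuousMap.continuous _)
    (fun s => Measure.measurePreserving_sub_left volume s) hp

/-- The operator of multiplication by an essentially bounded function. -/
def mulOp (p : ℝ≥0∞) [Fact (1 ≤ p)] (c : LpR ⊤) : LpR p →L[ℂ] LpR p :=
  (ContinuousLinearMap.mul ℂ ℂ).holderL volume ⊤ p p c

theorem isMulOp_mulOp (p : ℝ≥0∞) [Fact (1 ≤ p)] {c : ℝ → ℂ} (hc : MemLp c ⊤ volume) :
    IsMulOp p c (mulOp p hc.toLp) := fun f => by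
  filter_upwards [(ContinuousLinearMap.mul ℂ ℂ).coeFn_holder (r := p) hc.toLp f,
    hc.coeFn_toLp] with x h1 h2
  rw [mulOp, ContinuousLinearMap.holderL_apply_apply, h1, h2]
  rfl

theorem norm_le_of_isMulOp {p : ℝ≥0∞} [Fact (1 ≤ p)] {c : ℝ → ℂ} {C : ℝ}
    {T : LpR p →L[ℂ] LpR p} (hT : IsMulOp p c T) (hc : ∀ x, ‖c x‖ ≤ C) (f : LpR p) :
    ‖T f‖ ≤ C * ‖f‖ := by
  refine Lp.norm_le_mul_norm_of_ae_le_mul ?_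
  filter_upwards [hT f] with x hx
  rw [hx, norm_mul]
  gcongr
  exact hc x

theorem memLp_reflOp (q : ℝ≥0∞) [Fact (1 ≤ q)] (hq : q ≠ ⊤) (φ : LpR q) :
    MemLp (fun x => reflOp q x φ) ⊤ (volume : Measure ℝ) :=
  memLp_top_of_bound (continuous_reflOp_apply hq φ).aestronglyMeasurable ‖φ‖
    (.of_forall fun x => (norm_reflOp_apply q x φ).le)

/-- The map sending `φ` to the bounded `L^q(ℝ)`-valued function `x ↦ φ (x - ·)`. -/
def convKernel (q : ℝ≥0∞) [Fact (1 ≤ q)] (hq : q ≠ ⊤) :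
    LpR q →L[ℂ] MeasureTheory.Lp (LpR q) ⊤ (volume : Measure ℝ) :=
  LinearMap.mkContinuous
    { toFun := fun φ => (memLp_reflOp q hq φ).toLp
      map_add' := fun φ ψ => by
        rw [← MemLp.toLp_add]
        exact MemLp.toLp_congr _ _ (.of_forall fun x => map_add _ _ _)
      map_smul' := fun a φ => by
        rw [RingHom.id_apply, ← MemLp.toLp_const_smul]
        exact MemLp.toLp_congr _ _ (.of_forall fun x => map_smul _ _ _) } 1 fun φ => by
    rw [one_mul]
    refine (Lp.norm_toLp _ (memLp_reflOp q hq φ)).trans_le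
      (ENNReal.toReal_le_of_le_ofReal (norm_nonneg _) ?_)
    rw [eLpNorm_exponent_top]
    exact eLpNormEssSup_le_of_ae_bound (.of_forall fun x => (norm_reflOp_apply q x φ).le)

/-- The kernel `(x, y) ↦ h x * φ (x - y)` as a bilinear function of `h` and `φ`. -/
def mulConvKernel (p q : ℝ≥0∞) [Fact (1 ≤ p)] [Fact (1 ≤ q)] (hq : q ≠ ⊤) :
    LpR p →L[ℂ] LpR q →L[ℂ] LpLq p q :=
  ((((ContinuousLinearMap.lsmul ℂ ℂ).holderL volume p ⊤ p).flip).comp (convKernel q hq)).flip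

theorem coeFn_mulConvKernel (p q : ℝ≥0∞) [Fact (1 ≤ p)] [Fact (1 ≤ q)] (hq : q ≠ ⊤)
    (h : LpR p) (φ : LpR q) :
    ∀ᵐ x : ℝ, ((mulConvKernel p q hq h φ : ℝ → LpR q) x : ℝ → ℂ) =ᵐ[volume]
        fun y => (h : ℝ → ℂ) x * (φ : ℝ → ℂ) (x - y) := by
  filter_upwards [(ContinuousLinearMap.lsmul ℂ ℂ).coeFn_holder (r := p) h (convKernel q hq φ),
    (memLp_reflOp q hq φ).coeFn_toLp] with x h1 h2
  have h3 : (mulConvKernel p q hq h φ : ℝ → LpR q) x = (h : ℝ → ℂ) x • reflOp q x φ :=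
    h1.trans (congrArg _ h2)
  rw [h3]
  filter_upwards [Lp.coeFn_smul ((h : ℝ → ℂ) x) (reflOp q x φ), coeFn_reflOp q x φ] with y h4 h5
  rw [h4, Pi.smul_apply, h5, smul_eq_mul]

/-- Postcomposition of `L^p` functions with a continuous linear map, as a bilinear map. -/
def compLpBilin (p : ℝ≥0∞) [Fact (1 ≤ p)] (E F : Type*) [NormedAddCommGroup E] [NormedSpace ℂ E]
    [NormedAddCommGroup F] [NormedSpace ℂ F] :
    (E →L[ℂ] F) →L[ℂ] MeasureTheory.Lp E p (volume : Measure ℝ) →L[ℂ]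
      MeasureTheory.Lp F p (volume : Measure ℝ) :=
  LinearMap.mkContinuous
    { toFun := fun L : E →L[ℂ] F => L.compLpL p volume
      map_add' := fun L L' => ContinuousLinearMap.add_compLpL L L'
      map_smul' := fun a L => ContinuousLinearMap.smul_compLpL a L } 1 fun L => by
    rw [one_mul]
    exact ContinuousLinearMap.opNorm_le_bound _ (norm_nonneg _) L.norm_compLp_le

/-- The integral operator with a given kernel, as a linear function of the kernel. -/
def intOp (p q : ℝ≥0∞) [Fact (1 ≤ p)] [Fact (1 ≤ q)] [ENNReal.HolderConjugate q p] :
    LpLq p q →L[ℂ] LpR p →L[ℂ] LpR p :=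
  ((compLpBilin p (LpR q) ℂ).comp
    ((ContinuousLinearMap.mul ℂ ℂ).lpPairing volume q p).flip).flip

theorem isIntOp_intOp (p q : ℝ≥0∞) [Fact (1 ≤ p)] [Fact (1 ≤ q)] [ENNReal.HolderConjugate q p]
    (k : LpLq p q) : IsIntOp p q k (intOp p q k) := fun f => by
  filter_upwards [(((ContinuousLinearMap.mul ℂ ℂ).lpPairing volume q p).flip f).coeFn_compLpL
    (p := p) k] with x hx
  refine hx.trans ?_
  rw [ContinuousLinearMap.flip_apply, ContinuousLinearMap.lpPairing_eq_integral]
  rfl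

/-- The operator `M_h Δ_φ` as a bilinear function of `h` and `φ`. -/
def mulConvOp (p q : ℝ≥0∞) [Fact (1 ≤ p)] [Fact (1 ≤ q)] [ENNReal.HolderConjugate q p]
    (hq : q ≠ ⊤) (h : LpR p) (φ : LpR q) : LpR p →L[ℂ] LpR p :=
  intOp p q (mulConvKernel p q hq h φ)

theorem coeFn_mulConvOp (p q : ℝ≥0∞) [Fact (1 ≤ p)] [Fact (1 ≤ q)]
    [ENNReal.HolderConjugate q p] (hq : q ≠ ⊤) (h : LpR p) (φ : LpR q) (f : LpR p) :
    (mulConvOp p q hq h φ f : ℝ → ℂ) =ᵐ[volume] fun x =>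
        (h : ℝ → ℂ) x * ∫ y : ℝ, (φ : ℝ → ℂ) (x - y) * (f : ℝ → ℂ) y := by
  filter_upwards [isIntOp_intOp p q (mulConvKernel p q hq h φ) f,
    coeFn_mulConvKernel p q hq h φ] with x h1 h2
  rw [mulConvOp, h1, ← integral_const_mul]
  refine integral_congr_ae ?_
  filter_upwards [h2] with y h3
  rw [h3, mul_assoc]

theorem integrable_smul_of_norm_le {E : Type*} [NormedAddCommGroup E] [NormedSpace ℂ E]
    {a : ℝ → ℂ} (ha : Integrable a) {U : ℝ → E} (hU : AEStronglyMeasurable U volume) {C : ℝ}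
    (hC : ∀ s, ‖U s‖ ≤ C) : Integrable fun s => a s • U s :=
  ha.smul_bdd C hU (.of_forall hC)

/-- A Bochner integral in `L^p` is computed pointwise almost everywhere. -/
theorem coeFn_integral_smul {p q : ℝ≥0∞} [Fact (1 ≤ p)] [Fact (1 ≤ q)]
    [ENNReal.HolderConjugate q p] {a : ℝ → ℂ} (ha : Integrable a) {U : ℝ → LpR p}
    (hU : Continuous U) {C : ℝ} (hC : ∀ s, ‖U s‖ ≤ C) {u : ℝ → ℝ → ℂ}
    (hu : StronglyMeasurable (Function.uncurry u)) (hUu : ∀ s, (U s : ℝ → ℂ) =ᵐ[volume] u s) :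
    ((∫ s, a s • U s : LpR p) : ℝ → ℂ) =ᵐ[volume] fun x => ∫ s, a s * u s x := by
  have hp1 : 1 ≤ p := Fact.out
  have hInt : Integrable fun s => a s • U s :=
    integrable_smul_of_norm_le ha hU.aestronglyMeasurable hC
  have hUB : ∀ B : Set ℝ, volume B < ⊤ → ∀ f : LpR p, IntegrableOn f B := fun B hB f => by
    have : IsFiniteMeasure (volume.restrict B) := ⟨by simpa using hB⟩
    exact ((Lp.memLp f).restrict B).integrable hp1
  have hprod : ∀ B : Set ℝ, MeasurableSet B → volume B < ⊤ →
      Integrable (Function.uncurry fun s x => a s * u s x)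
        ((volume : Measure ℝ).prod (volume.restrict B)) := by
    intro B hB hBfin
    have : IsFiniteMeasure (volume.restrict B) := ⟨by simpa using hBfin⟩
    have hUu' : ∀ s, (U s : ℝ → ℂ) =ᵐ[volume.restrict B] u s := fun s => ae_restrict_of_ae (hUu s)
    have hus : ∀ s, Integrable (u s) (volume.restrict B) := fun s =>
      (hUB B hBfin (U s)).congr (hUu' s)
    have hmeas : AEStronglyMeasurable (Function.uncurry fun s x => a s * u s x)
        ((volume : Measure ℝ).prod (volume.restrict B)) :=
      ha.aestronglyMeasurable.comp_fst.mul hu.aestronglyMeasurable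
    set K : ℝ≥0∞ := (volume.restrict B) Set.univ ^ (1 / (1 : ℝ≥0∞).toReal - 1 / p.toReal) with hK
    have hKfin : K ≠ ⊤ := by
      refine ENNReal.rpow_ne_top_of_nonneg ?_ (measure_ne_top _ _)
      rcases eq_or_ne p ⊤ with rfl | hp
      · simp
      · have h1 : 1 ≤ p.toReal := by simpa using ENNReal.toReal_mono hp hp1
        simpa using inv_le_one_of_one_le₀ h1
    have hbound : ∀ s, ∫ x in B, ‖u s x‖ ≤ C * K.toReal := fun s => by
      have h1 : eLpNorm (u s) 1 (volume.restrict B) ≤ ENNReal.ofReal C * K := by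
        rw [← eLpNorm_congr_ae (hUu' s)]
        refine (eLpNorm_le_eLpNorm_mul_rpow_measure_univ hp1
          (Lp.aestronglyMeasurable (U s)).restrict).trans ?_
        gcongr
        refine (eLpNorm_mono_measure _ Measure.restrict_le_self).trans ?_
        rw [← Lp.enorm_def, ← ofReal_norm]
        exact ENNReal.ofReal_le_ofReal (hC s)
      have hC0 : 0 ≤ C := (norm_nonneg _).trans (hC s)
      rw [integral_norm_eq_lintegral_enorm (hus s).aestronglyMeasurable,
        ← eLpNorm_one_eq_lintegral_enorm, ← ENNReal.toReal_ofReal hC0, ← ENNReal.toReal_mul]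
      exact ENNReal.toReal_mono (ENNReal.mul_ne_top ENNReal.ofReal_ne_top hKfin) h1
    refine (integrable_prod_iff hmeas).2 ⟨.of_forall fun s => (hus s).const_mul (a s), ?_⟩
    refine (ha.norm.mul_const (C * K.toReal)).mono' hmeas.norm.integral_prod_right'
      (.of_forall fun s => ?_)
    simp only [Function.uncurry_apply_pair, norm_mul, integral_const_mul, norm_norm]
    rw [Real.norm_of_nonneg (integral_nonneg fun x => norm_nonneg _)]
    exact mul_le_mul_of_nonneg_left (hbound s) (norm_nonneg _)
  refine ae_eq_of_forall_setIntegral_eq_of_sigmaFinite (fun B _ hB => hUB B hB _)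
    (fun B hB hB' => (hprod B hB hB').integral_prod_right) fun B hB hBfin => ?_
  have hpair : ∀ f : LpR p, (ContinuousLinearMap.mul ℂ ℂ).lpPairing volume q p
      (indicatorConstLp q hB hBfin.ne 1) f = ∫ x in B, (f : ℝ → ℂ) x := fun f => by
    rw [ContinuousLinearMap.lpPairing_eq_integral, ← integral_indicator hB]
    refine integral_congr_ae ?_
    filter_upwards [indicatorConstLp_coeFn (p := q) (hs := hB) (hμs := hBfin.ne)
      (c := (1 : ℂ))] with x hx
    rw [hx]
    by_cases hxB : x ∈ B <;> simp [hxB]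
  rw [← hpair, ← ContinuousLinearMap.integral_comp_comm _ hInt,
    ← integral_integral_swap (hprod B hB hBfin)]
  refine integral_congr_ae (.of_forall fun s => ?_)
  simp only [hpair]
  refine integral_congr_ae (ae_restrict_of_ae ?_)
  filter_upwards [hUu s, Lp.coeFn_smul (a s) (U s)] with x hx hx'
  rw [hx', Pi.smul_apply, hx, smul_eq_mul]

theorem Submodule.integral_mem_of_isClosed {E : Type*} [NormedAddCommGroup E] [NormedSpace ℂ E]
    [CompleteSpace E] {N : Submodule ℂ E} (hN : IsClosed (N : Set E)) {f : ℝ → E}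
    (hf : ∀ s, f s ∈ N) : ∫ s, f s ∈ N := by
  have : CompleteSpace N := hN.completeSpace_coe
  have h := N.subtypeₗᵢ.integral_comp_comm (μ := volume) fun s => (⟨f s, hf s⟩ : N)
  rw [show ∫ s, f s = _ from h]
  exact Subtype.mem _

/-- An operator given by a strong integral of elements of a strongly closed subalgebra belongs to
the subalgebra. -/
theorem IsSOTClosed.mem_of_integral {p : ℝ≥0∞} [Fact (1 ≤ p)]
    {A : Subalgebra ℂ (LpR p →L[ℂ] LpR p)} (hA : IsSOTClosed p (A : Set (LpR p →L[ℂ] LpR p)))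
    {T : LpR p →L[ℂ] LpR p} {U : ℝ → LpR p →L[ℂ] LpR p} (hU : ∀ s, U s ∈ A)
    (hint : ∀ f, Integrable fun s => U s f) (hT : ∀ f, T f = ∫ s, U s f) : T ∈ A := by
  refine hA T (mem_closure_iff.2 fun o ho hTo => ?_)
  obtain ⟨I, u, hu, huo⟩ := isOpen_pi_iff.1 ho _ hTo
  let r : (LpR p →L[ℂ] LpR p) →ₗ[ℂ] (I → LpR p) :=
    { toFun := fun S i => S i
      map_add' := fun _ _ => rfl
      map_smul' := fun _ _ => rfl }
  let N : Submodule ℂ (I → LpR p) := (A.toSubmodule.map r).topologicalClosure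
  have hmem : (fun i : I => T i) ∈ N := by
    have h : (fun i : I => T i) = ∫ s, r (U s) := by
      funext i
      rw [hT, eval_integral (f := fun s => r (U s))]
      · rfl
      · exact fun j => hint j
    rw [h]
    exact Submodule.integral_mem_of_isClosed (Submodule.isClosed_topologicalClosure _)
      fun s => Submodule.le_topologicalClosure _ ⟨U s, hU s, rfl⟩
  obtain ⟨y, hy, S, hS, rfl⟩ := mem_closure_iff.1 hmem
    (Set.univ.pi fun i : I => u i) (isOpen_set_pi Set.finite_univ fun i _ => (hu i i.2).1)
    fun i _ => (hu i i.2).2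
  exact ⟨S, huo fun i hi => hy ⟨i, hi⟩ trivial, S, hS, rfl⟩

theorem IsSOTClosed.isClosed {p : ℝ≥0∞} [Fact (1 ≤ p)] {S : Set (LpR p →L[ℂ] LpR p)}
    (hS : IsSOTClosed p S) : IsClosed S := by
  refine isClosed_of_closure_subset fun T hT => hS T ?_
  have hc : Continuous fun A : LpR p →L[ℂ] LpR p => (A : LpR p → LpR p) :=
    continuous_pi fun f => (ContinuousLinearMap.apply ℂ (LpR p) f).continuous
  exact image_closure_subset_closure_image hc ⟨T, hT, rfl⟩

theorem add_ofReal_ne_zero {u : ℂ} (hu : 0 < u.im) (x : ℝ) : (x : ℂ) + u ≠ 0 := fun h => by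
  have := congrArg Complex.im h
  simp at this
  exact hu.ne' this

theorem norm_inv_add_le {u : ℂ} (hu : 0 < u.im) (x : ℝ) : ‖((x : ℂ) + u)⁻¹‖ ≤ u.im⁻¹ := by
  rw [norm_inv]
  refine inv_anti₀ hu ?_
  simpa [abs_of_pos hu] using Complex.abs_im_le_norm ((x : ℂ) + u)

theorem continuous_inv_add {u : ℂ} (hu : 0 < u.im) : Continuous fun x : ℝ => ((x : ℂ) + u)⁻¹ :=
  (by fun_prop : Continuous fun x : ℝ => (x : ℂ) + u).inv₀ (add_ofReal_ne_zero hu)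

theorem memLp_inv_add {u : ℂ} (hu : 0 < u.im) {p : ℝ≥0∞} (hp : 1 < p) (hp' : p ≠ ⊤) :
    MemLp (fun x : ℝ => ((x : ℂ) + u)⁻¹) p volume := by
  have hp1 : 1 < p.toReal := by simpa using ENNReal.toReal_strict_mono hp' hp
  have h1 : MemLp (fun x : ℝ => (1 + ‖x‖)⁻¹) p volume := by
    have hm : Measurable fun x : ℝ => (1 + ‖x‖)⁻¹ := by fun_prop
    rw [← integrable_norm_rpow_iff hm.aestronglyMeasurable
      (zero_lt_one.trans hp).ne' hp']
    refine (integrable_one_add_norm (E := ℝ) (μ := volume) (r := p.toReal)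
      (by simpa using hp1)).congr (.of_forall fun x => ?_)
    have h0 : 0 ≤ 1 + ‖x‖ := by positivity
    simp only
    rw [Real.norm_of_nonneg (inv_nonneg.2 h0), Real.inv_rpow h0, Real.rpow_neg h0]
  refine h1.of_le_mul (c := 1 + (1 + ‖u‖) / u.im) (continuous_inv_add hu).aestronglyMeasurable
    (.of_forall fun x => ?_)
  have h0 : 0 < 1 + ‖x‖ := by positivity
  have h2 : u.im ≤ ‖(x : ℂ) + u‖ := by
    simpa [abs_of_pos hu] using Complex.abs_im_le_norm ((x : ℂ) + u)
  have h3 : ‖x‖ ≤ ‖(x : ℂ) + u‖ + ‖u‖ := by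
    have := norm_sub_le ((x : ℂ) + u) u
    rwa [add_sub_cancel_right, Complex.norm_real] at this
  have h4 : 1 + ‖u‖ ≤ (1 + ‖u‖) / u.im * ‖(x : ℂ) + u‖ := by
    rw [div_mul_eq_mul_div, le_div_iff₀ hu]
    gcongr
  rw [norm_inv, Real.norm_of_nonneg (inv_nonneg.2 h0.le), ← div_eq_mul_inv, le_div_iff₀ h0,
    inv_mul_le_iff₀ (hu.trans_le h2)]
  linarith

theorem memLp_exp_I_mul (l : ℝ) :
    MemLp (fun x : ℝ => Complex.exp (Complex.I * l * x)) ⊤ volume :=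
  memLp_top_of_bound (by fun_prop : Continuous _).aestronglyMeasurable 1
    (.of_forall fun x => by
      rw [show Complex.I * l * x = ((l * x : ℝ) : ℂ) * Complex.I by push_cast; ring,
        Complex.norm_exp_ofReal_mul_I])

/-- The operator of multiplication by `(x + u)⁻¹` is the Laplace transform of the multiplication
semigroup. -/
theorem isMulOp_inv_add_mem {p : ℝ≥0∞} (q : ℝ≥0∞) [Fact (1 ≤ p)] [Fact (1 ≤ q)]
    [ENNReal.HolderConjugate q p]
    {A : Subalgebra ℂ (LpR p →L[ℂ] LpR p)}
    (hgens : parabolicGens p ⊆ A) (hA : IsSOTClosed p (A : Set (LpR p →L[ℂ] LpR p)))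
    (hp : p ≠ ⊤) {u : ℂ} (hu : 0 < u.im) {R : LpR p →L[ℂ] LpR p}
    (hR : IsMulOp p (fun x => ((x : ℂ) + u)⁻¹) R) : R ∈ A := by
  let e : ℝ → LpR p →L[ℂ] LpR p := fun l => mulOp p (memLp_exp_I_mul l).toLp
  have he : ∀ l : ℝ, IsMulOp p (fun x => Complex.exp (Complex.I * l * x)) (e l) := fun l =>
    isMulOp_mulOp p (memLp_exp_I_mul l)
  have hnorm : ∀ l x : ℝ, ‖Complex.exp (Complex.I * l * x)‖ ≤ 1 := fun l x => by
    rw [show Complex.I * l * x = ((l * x : ℝ) : ℂ) * Complex.I by push_cast; ring,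
      Complex.norm_exp_ofReal_mul_I]
  have hre : (Complex.I * u).re < 0 := by simpa using hu
  let a : ℝ → ℂ := (Set.Ioi (0 : ℝ)).indicator
    fun s => -Complex.I * Complex.exp (Complex.I * u * s)
  have ha : Integrable a :=
    IntegrableOn.integrable_indicator ((integrableOn_exp_mul_complex_Ioi hre 0).const_mul _)
      measurableSet_Ioi
  have hcont : ∀ f, Continuous fun s => e s f := fun f => continuous_iff_continuousAt.2 fun s =>
    tendsto_Lp_of_mul_dominated hp (fun i => he i f) (he s f) hnorm (hnorm s) fun x =>
      (by fun_prop : Continuous fun l : ℝ => Complex.exp (Complex.I * l * x)).tendsto s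
  have hle : ∀ f s, ‖e s f‖ ≤ ‖f‖ := fun f s => by
    simpa using norm_le_of_isMulOp (he s) (hnorm s) f
  refine hA.mem_of_integral (U := fun s => a s • e s) (fun s => ?_)
    (fun f => integrable_smul_of_norm_le ha (hcont f).aestronglyMeasurable (hle f)) fun f => ?_
  · by_cases hs : 0 < s
    · exact A.smul_mem (hgens (.inl ⟨s, hs.le, he s⟩)) _
    · simp [a, hs]
  · refine Lp.ext ((hR f).trans ?_)
    refine .trans ?_ (coeFn_integral_smul (q := q) ha (hcont f) (hle f)
      (u := fun s x => Complex.exp (Complex.I * s * x) * (f : ℝ → ℂ) x) ?_ fun s => he s f).symm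
    · refine .of_forall fun x => ?_
      have hre' : (Complex.I * (x + u)).re < 0 := by simpa using hu
      have h1 : ∀ s : ℝ, a s * (Complex.exp (Complex.I * s * x) * (f : ℝ → ℂ) x) =
          (Set.Ioi (0 : ℝ)).indicator (fun s : ℝ => -Complex.I * (f : ℝ → ℂ) x *
            Complex.exp (Complex.I * (x + u) * s)) s := fun s => by
        by_cases hs : 0 < s
        · simp only [a, Set.indicator_of_mem (Set.mem_Ioi.2 hs)]
          rw [show Complex.I * (x + u) * s = Complex.I * u * s + Complex.I * s * x by ring,
            Complex.exp_add]
          ring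
        · simp [a, hs]
      simp only [h1]
      rw [integral_indicator measurableSet_Ioi, integral_const_mul,
        integral_exp_mul_complex_Ioi hre' 0]
      have := add_ofReal_ne_zero hu x
      simp
      field_simp
    · exact (by fun_prop : Continuous fun z : ℝ × ℝ =>
        Complex.exp (Complex.I * z.1 * z.2)).stronglyMeasurable.mul
        ((Lp.stronglyMeasurable f).comp_measurable measurable_snd)

section

variable {p q : ℝ≥0∞} [Fact (1 ≤ p)] [Fact (1 ≤ q)] [ENNReal.HolderConjugate q p]

theorem mulConvOp_mem_of_integrable {A : Subalgebra ℂ (LpR p →L[ℂ] LpR p)}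
    (hgens : parabolicGens p ⊆ A) (hA : IsSOTClosed p (A : Set (LpR p →L[ℂ] LpR p)))
    (hp : p ≠ ⊤) (hq : q ≠ ⊤) {m : LpR p} {M : LpR p →L[ℂ] LpR p} (hM : IsMulOp p m M)
    (hMA : M ∈ A) {φ : LpR q} (hφ : Integrable φ)
    (hφ0 : ∀ᵐ y : ℝ, y < 0 → (φ : ℝ → ℂ) y = 0) : mulConvOp p q hq m φ ∈ A := by
  let a : ℝ → ℂ := (Set.Ici (0 : ℝ)).indicator φ
  have ha : Integrable a := hφ.indicator measurableSet_Ici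
  have haφ : a =ᵐ[volume] φ := by
    filter_upwards [hφ0] with y hy
    by_cases h : 0 ≤ y
    · simp [a, h]
    · simp [a, h, hy (not_le.1 h)]
  have hcont := continuous_transOp_apply (p := p) hp
  have hle : ∀ f s, ‖transOp p s f‖ ≤ ‖f‖ := fun f s => (norm_transOp_apply p s f).le
  have hint : ∀ f, Integrable fun s => a s • transOp p s f := fun f =>
    integrable_smul_of_norm_le ha (hcont f).aestronglyMeasurable (hle f)
  refine hA.mem_of_integral (U := fun s => M * (a s • transOp p s)) (fun s => ?_)
    (fun f => M.integrable_comp (hint f)) fun f => ?_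
  · by_cases hs : 0 ≤ s
    · exact A.mul_mem hMA (A.smul_mem (hgens (.inr ⟨s, hs, isTransOp_transOp p s⟩)) _)
    · simp [a, hs]
  · refine .trans ?_ (M.integral_comp_comm (hint f)).symm
    refine Lp.ext ?_
    filter_upwards [coeFn_mulConvOp p q hq m φ f, hM (∫ s, a s • transOp p s f),
      coeFn_integral_smul (q := q) ha (hcont f) (hle f)
        (u := fun s x => (f : ℝ → ℂ) (x - s))
        ((Lp.stronglyMeasurable f).comp_measurable (measurable_snd.sub measurable_fst))
        fun s => isTransOp_transOp p s f] with x h1 h2 h3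
    rw [h1, h2, h3, ← integral_sub_left_eq_self _ _ x]
    congr 1
    refine integral_congr_ae ?_
    filter_upwards [haφ] with s hs
    rw [hs, sub_sub_cancel]

theorem mulConvOp_mem_of_isMulOp {A : Subalgebra ℂ (LpR p →L[ℂ] LpR p)}
    (hgens : parabolicGens p ⊆ A) (hA : IsSOTClosed p (A : Set (LpR p →L[ℂ] LpR p)))
    (hp : p ≠ ⊤) (hq : q ≠ ⊤) {m : LpR p} {M : LpR p →L[ℂ] LpR p} (hM : IsMulOp p m M)
    (hMA : M ∈ A) {φ : LpR q} (hφ0 : ∀ᵐ y : ℝ, y < 0 → (φ : ℝ → ℂ) y = 0) :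
    mulConvOp p q hq m φ ∈ A := by
  have hmem : ∀ n : ℕ, MemLp ((Set.Icc (0 : ℝ) n).indicator φ) q volume := fun n =>
    (Lp.memLp φ).indicator measurableSet_Icc
  have hlim : Tendsto (fun n => (hmem n).toLp) atTop (𝓝 φ) := by
    refine tendsto_Lp_of_mul_dominated hq (g := φ) (C := 1)
      (c := fun n => (Set.Icc (0 : ℝ) n).indicator 1) (c₀ := (Set.Ici (0 : ℝ)).indicator 1)
      (fun n => ?_) ?_ (fun n x => ?_) (fun x => ?_) fun x => ?_
    · filter_upwards [(hmem n).coeFn_toLp] with x hx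
      rw [hx]
      by_cases h : x ∈ Set.Icc (0 : ℝ) n <;> simp [h]
    · filter_upwards [hφ0] with x hx
      by_cases h : 0 ≤ x
      · simp [h]
      · simp [h, hx (not_le.1 h)]
    · simpa using norm_indicator_le_norm_self (1 : ℝ → ℂ) x
    · simpa using norm_indicator_le_norm_self (1 : ℝ → ℂ) x
    · refine tendsto_const_nhds.congr' ?_
      filter_upwards [tendsto_natCast_atTop_atTop.eventually_ge_atTop x] with n hn
      by_cases h : 0 ≤ x <;> simp [h, hn]
  have hc : Continuous fun ψ => mulConvOp p q hq m ψ :=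
    ((intOp p q).comp (mulConvKernel p q hq m)).continuous
  refine hA.isClosed.mem_of_tendsto ((hc.tendsto φ).comp hlim) (.of_forall fun n => ?_)
  have : IsFiniteMeasure ((volume : Measure ℝ).restrict (Set.Icc (0 : ℝ) n)) :=
    ⟨by simp⟩
  refine mulConvOp_mem_of_integrable hgens hA hp hq hM hMA ?_ ?_
  · refine Integrable.congr ?_ (hmem n).coeFn_toLp.symm
    refine IntegrableOn.integrable_indicator ?_ measurableSet_Icc
    exact ((Lp.memLp φ).restrict _).integrable Fact.out
  · filter_upwards [(hmem n).coeFn_toLp] with x hx hx0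
    simp [hx, hx0.not_ge]

end

theorem transOp_zero (p : ℝ≥0∞) [Fact (1 ≤ p)] (f : LpR p) : transOp p 0 f = f :=
  Lp.ext ((isTransOp_transOp p 0 f).trans (.of_forall fun x => by simp only [sub_zero]))

/-- The Cauchy kernel `x ↦ (π (1 + x ^ 2))⁻¹`. -/
def cauchyKernel (s : ℝ) : ℂ := ((Real.pi⁻¹ * (1 + s ^ 2)⁻¹ : ℝ) : ℂ)

theorem integrable_cauchyKernel : Integrable cauchyKernel :=
  (integrable_inv_one_add_sq.const_mul _).ofReal

theorem integral_cauchyKernel : ∫ s, cauchyKernel s = 1 := by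
  rw [show ∫ s, cauchyKernel s = ((∫ s : ℝ, Real.pi⁻¹ * (1 + s ^ 2)⁻¹ : ℝ) : ℂ) from
    integral_ofReal, integral_const_mul, integral_univ_inv_one_add_sq,
    inv_mul_cancel₀ Real.pi_ne_zero, Complex.ofReal_one]

theorem tendsto_integral_cauchyKernel_smul_transOp {p : ℝ≥0∞} [Fact (1 ≤ p)] (hp : p ≠ ⊤)
    (g : LpR p) :
    Tendsto (fun ε : ℝ => ∫ s, cauchyKernel s • transOp p (ε * s) g) (𝓝[>] 0) (𝓝 g) := by
  have hcont := continuous_transOp_apply hp g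
  have h0 : ∫ s, cauchyKernel s • g = g := by
    rw [integral_smul_const, integral_cauchyKernel, one_smul]
  nth_rewrite 2 [← h0]
  refine tendsto_integral_filter_of_dominated_convergence (fun s => ‖cauchyKernel s‖ * ‖g‖)
    (.of_forall fun ε => ?_) (.of_forall fun ε => .of_forall fun s => ?_)
    (integrable_cauchyKernel.norm.mul_const _) (.of_forall fun s => ?_)
  · exact integrable_cauchyKernel.aestronglyMeasurable.smul
      (hcont.comp (continuous_const.mul continuous_id)).aestronglyMeasurable
  · rw [norm_smul, norm_transOp_apply]
  · have h1 : Tendsto (fun ε : ℝ => transOp p (ε * s) g) (𝓝 0) (𝓝 g) := by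
      have := (hcont.comp (continuous_id.mul (continuous_const (y := s)))).tendsto (0 : ℝ)
      simpa [Function.comp_def, transOp_zero] using this
    exact (h1.mono_left nhdsWithin_le_nhds).const_smul _

theorem cauchyKernel_div {ε : ℝ} (hε : 0 < ε) (x t : ℝ) :
    cauchyKernel ((x - t) / ε) = -((ε : ℂ) / (2 * Real.pi * I)) *
      (((t : ℂ) + (-x + ε * I))⁻¹ + ((x : ℂ) + (-t + ε * I))⁻¹) := by
  have h1 := add_ofReal_ne_zero (u := -x + ε * I) (by simpa using hε) t
  have h2 := add_ofReal_ne_zero (u := -t + ε * I) (by simpa using hε) x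
  have h3 : ((1 + ((x - t) / ε) ^ 2 : ℝ) : ℂ) ≠ 0 := by
    norm_cast
    positivity
  have h4 : (ε : ℂ) ≠ 0 := by exact_mod_cast hε.ne'
  have h5 : (Real.pi : ℂ) ≠ 0 := by exact_mod_cast Real.pi_ne_zero
  have h6 : ((1 + ((x - t) / ε) ^ 2 : ℝ) : ℂ) =
      -(((t : ℂ) + (-x + ε * I)) * ((x : ℂ) + (-t + ε * I))) / ε ^ 2 := by
    push_cast
    field_simp
    ring_nf
    simp [I_sq]
  rw [cauchyKernel, Complex.ofReal_mul, Complex.ofReal_inv, Complex.ofReal_inv, h6]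
  field_simp
  ring_nf

/-- A closed subspace containing every `(x + u)⁻¹`, `u` in the upper half-plane, contains the
integrable functions of the Hardy space. -/
theorem mem_of_integrable_of_integral_div_eq_zero {p q : ℝ≥0∞} [Fact (1 ≤ p)] [Fact (1 ≤ q)]
    [ENNReal.HolderConjugate q p] (hp : 1 < p) (hp' : p ≠ ⊤) {V : Submodule ℂ (LpR p)}
    (hV : IsClosed (V : Set (LpR p)))
    (hres : ∀ (u : ℂ) (m : LpR p), 0 < u.im →
      (m : ℝ → ℂ) =ᵐ[volume] (fun x => ((x : ℂ) + u)⁻¹) → m ∈ V)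
    {g : LpR p} (hg : Integrable g) (hg0 : ∀ u : ℂ, 0 < u.im → u.im < 1 →
      ∫ x : ℝ, (g : ℝ → ℂ) x / ((x : ℂ) + u) = 0) : g ∈ V := by
  have hcont := fun f : LpR p => continuous_transOp_apply hp' f
  refine hV.mem_of_tendsto (tendsto_integral_cauchyKernel_smul_transOp hp' g) ?_
  filter_upwards [Ioo_mem_nhdsGT (zero_lt_one' ℝ)] with ε ⟨hε, hε1⟩
  have him : 0 < (ε * I : ℂ).im := by simpa using hε
  have hmem := memLp_inv_add him hp hp'
  let m : LpR p := hmem.toLp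
  have hm : ∀ t, (transOp p t m : ℝ → ℂ) =ᵐ[volume] fun x => ((x : ℂ) + (-t + ε * I))⁻¹ := by
    intro t
    filter_upwards [isTransOp_transOp p t m,
      (measurePreserving_sub_right volume t).quasiMeasurePreserving.ae hmem.coeFn_toLp] with x h1 h2
    rw [h1, h2]
    push_cast
    ring_nf
  have hW : ∫ s, cauchyKernel s • transOp p (ε * s) g =
      -(1 / (2 * Real.pi * I) : ℂ) • ∫ t, (g : ℝ → ℂ) t • transOp p t m := by
    refine Lp.ext ?_
    filter_upwards [Lp.coeFn_smul (-(1 / (2 * Real.pi * I) : ℂ))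
        (∫ t, (g : ℝ → ℂ) t • transOp p t m),
      coeFn_integral_smul (q := q) integrable_cauchyKernel
        (U := fun s => transOp p (ε * s) g) ((hcont g).comp (continuous_const.mul continuous_id))
        (fun s => (norm_transOp_apply p (ε * s) g).le)
        (u := fun s x => (g : ℝ → ℂ) (x - ε * s))
        ((Lp.stronglyMeasurable g).comp_measurable (by fun_prop))
        (fun s => isTransOp_transOp p (ε * s) g),
      coeFn_integral_smul (q := q) hg (hcont m) (fun s => (norm_transOp_apply p s m).le)
        (u := fun t x => ((x : ℂ) + (-t + ε * I))⁻¹)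
        (by fun_prop : Measurable fun z : ℝ × ℝ =>
          ((z.2 : ℂ) + (-z.1 + ε * I))⁻¹).stronglyMeasurable hm] with x h1 h2 h3
    have hux : 0 < (-x + ε * I : ℂ).im := by simpa using hε
    have hux1 : (-x + ε * I : ℂ).im < 1 := by simpa using hε1
    have hi1 : Integrable fun t : ℝ => (g : ℝ → ℂ) t * ((t : ℂ) + (-x + ε * I))⁻¹ :=
      hg.mul_bdd (continuous_inv_add hux).aestronglyMeasurable
        (.of_forall (norm_inv_add_le hux))
    have hi2 : Integrable fun t : ℝ => (g : ℝ → ℂ) t * ((x : ℂ) + (-t + ε * I))⁻¹ := by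
      refine hg.mul_bdd (c := ε⁻¹) (by fun_prop : Measurable fun t : ℝ =>
        ((x : ℂ) + (-t + ε * I))⁻¹).aestronglyMeasurable (.of_forall fun t => ?_)
      simpa using norm_inv_add_le (u := -t + ε * I) (by simpa using hε) x
    have hz : ∫ t : ℝ, (g : ℝ → ℂ) t * ((t : ℂ) + (-x + ε * I))⁻¹ = 0 := hg0 _ hux hux1
    rw [h1, Pi.smul_apply, h2, h3, smul_eq_mul]
    have h4 := Measure.integral_comp_mul_left
      (fun r => cauchyKernel (r / ε) * (g : ℝ → ℂ) (x - r)) ε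
    simp only [mul_div_cancel_left₀ _ hε.ne'] at h4
    rw [h4, ← integral_sub_left_eq_self _ _ x]
    simp only [sub_sub_cancel, cauchyKernel_div hε]
    have h5 : ∀ t : ℝ, -((ε : ℂ) / (2 * Real.pi * I)) *
      (((t : ℂ) + (-x + ε * I))⁻¹ + ((x : ℂ) + (-t + ε * I))⁻¹) * (g : ℝ → ℂ) t =
        -((ε : ℂ) / (2 * Real.pi * I)) * ((g : ℝ → ℂ) t * ((t : ℂ) + (-x + ε * I))⁻¹ +
          (g : ℝ → ℂ) t * ((x : ℂ) + (-t + ε * I))⁻¹) := fun t => by ring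
    simp only [h5]
    rw [integral_const_mul, integral_add hi1 hi2, hz, zero_add, abs_of_pos (inv_pos.2 hε),
      Complex.real_smul]
    have h6 : (ε : ℂ) ≠ 0 := by exact_mod_cast hε.ne'
    push_cast
    field_simp
  rw [hW]
  exact V.smul_mem _ (Submodule.integral_mem_of_isClosed hV fun t =>
    V.smul_mem _ (hres _ _ (by simpa using hε) (hm t)))

/-- A closed subspace containing every `(x + u)⁻¹`, `u` in the upper half-plane, contains the
Hardy space. -/
theorem hardy_subset_of_isClosed {p q : ℝ≥0∞} [Fact (1 ≤ p)] [Fact (1 ≤ q)]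
    [ENNReal.HolderConjugate q p] (hp : 1 < p) (hp' : p ≠ ⊤) (hq : 1 < q) (hq' : q ≠ ⊤)
    {V : Submodule ℂ (LpR p)} (hV : IsClosed (V : Set (LpR p)))
    (hres : ∀ (u : ℂ) (m : LpR p), 0 < u.im →
      (m : ℝ → ℂ) =ᵐ[volume] (fun x => ((x : ℂ) + u)⁻¹) → m ∈ V) :
    hardy p ⊆ V := by
  intro h hh
  have hint : ∀ u : ℂ, 0 < u.im → Integrable fun x : ℝ => ((x : ℂ) + u)⁻¹ * (h : ℝ → ℂ) x :=
    fun u hu => (memLp_inv_add hu hq hq').integrable_mul (Lp.memLp h)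
  let v : ℕ → ℂ := fun n => (n + 1 : ℝ) * I
  have hvim : ∀ n, (v n).im = n + 1 := fun n => by simp [v]
  have hv : ∀ n, 0 < (v n).im := fun n => by rw [hvim]; positivity
  have hvn : ∀ n, ‖v n‖ = (v n).im := fun n => by
    rw [hvim, norm_mul, norm_I, mul_one, Complex.norm_real, Real.norm_of_nonneg (by positivity)]
  let c : ℕ → ℝ → ℂ := fun n x => v n * ((x : ℂ) + v n)⁻¹
  have hc : ∀ n x, ‖c n x‖ ≤ 1 := fun n x => by
    rw [norm_mul, hvn, ← mul_inv_cancel₀ (hv n).ne']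
    exact mul_le_mul_of_nonneg_left (norm_inv_add_le (hv n) x) (hv n).le
  have hcm : ∀ n, MemLp (c n) ⊤ volume := fun n =>
    memLp_top_of_bound ((continuous_inv_add (hv n)).const_mul _).aestronglyMeasurable 1
      (.of_forall (hc n))
  have hG := fun n => isMulOp_mulOp p (hcm n) h
  have hlim : Tendsto (fun n => mulOp p (hcm n).toLp h) atTop (𝓝 h) := by
    refine tendsto_Lp_of_mul_dominated hp' (c := c) (c₀ := fun _ => 1) hG
      (.of_forall fun x => (one_mul _).symm) hc (by simp) fun x => ?_
    rw [tendsto_iff_norm_sub_tendsto_zero]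
    refine squeeze_zero (fun n => norm_nonneg _) (fun n => ?_)
      (g := fun n : ℕ => |x| * (1 / ((n : ℝ) + 1))) ?_
    · have h1 : c n x - 1 = -(x * ((x : ℂ) + v n)⁻¹) := by
        have := mul_inv_cancel₀ (add_ofReal_ne_zero (hv n) x)
        linear_combination this
      rw [h1, norm_neg, norm_mul, Complex.norm_real, Real.norm_eq_abs, one_div, ← hvim n]
      exact mul_le_mul_of_nonneg_left (norm_inv_add_le (hv n) x) (abs_nonneg x)
    · simpa using tendsto_one_div_add_atTop_nhds_zero_nat.const_mul |x|
  refine hV.mem_of_tendsto hlim (.of_forall fun n => ?_)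
  refine mem_of_integrable_of_integral_div_eq_zero (q := q) hp hp' hV hres ?_ fun u hu hu1 => ?_
  · refine ((hint _ (hv n)).const_mul (v n)).congr ?_
    filter_upwards [hG n] with x hx
    rw [hx, ← mul_assoc]
  · have huv : u - v n ≠ 0 := fun h0 => by
      have := congrArg Complex.im (sub_eq_zero.1 h0)
      rw [hvim] at this
      have : (0 : ℝ) ≤ n := n.cast_nonneg
      linarith
    have hz : ∀ w : ℂ, 0 < w.im → ∫ x : ℝ, ((x : ℂ) + w)⁻¹ * (h : ℝ → ℂ) x = 0 := fun w hw => by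
      simpa only [div_eq_inv_mul] using hh w hw
    have h1 : ∫ x : ℝ, (mulOp p (hcm n).toLp h : ℝ → ℂ) x / ((x : ℂ) + u) =
        ∫ x : ℝ, v n / (u - v n) * (((x : ℂ) + v n)⁻¹ * (h : ℝ → ℂ) x -
          ((x : ℂ) + u)⁻¹ * (h : ℝ → ℂ) x) := by
      refine integral_congr_ae ?_
      filter_upwards [hG n] with x hx
      have h2 := add_ofReal_ne_zero (hv n) x
      have h3 := add_ofReal_ne_zero hu x
      rw [hx]
      simp only [c]
      field_simp
      ring
    rw [h1, integral_const_mul, integral_sub (hint _ (hv n)) (hint _ hu), hz _ (hv n), hz _ hu]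
    simp

/-- For `h ∈ H^p(ℝ)` and `φ ∈ L^q(ℝ)` vanishing a.e. on `(-∞,0)`, the
kernel `k(x)(y) = h(x)φ(x-y)` lies in `L^p(ℝ;L^q(ℝ))`, `Int k = M_h Δ_φ`, and
`Int k ∈ G^p ∩ A_par^p`. -/
theorem mul_conv_kernel_in_parabolicAlgebra
    (p q : ℝ≥0∞) [Fact (1 ≤ p)] [Fact (1 ≤ q)]
    (hp : 1 < p) (hp' : p ≠ ⊤) (hq : 1 < q) (hq' : q ≠ ⊤)
    (hpq : 1 / p + 1 / q = 1)
    (h : LpR p) (hh : h ∈ hardy p)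
    (φ : LpR q) (hφ : ∀ᵐ y : ℝ, y < 0 → (φ : ℝ → ℂ) y = 0) :
    ∃ (k : LpLq p q) (T : LpR p →L[ℂ] LpR p),
      (∀ᵐ x : ℝ, (((k : ℝ → LpR q) x : ℝ → ℂ)) =ᵐ[volume]
        fun y => (h : ℝ → ℂ) x * (φ : ℝ → ℂ) (x - y)) ∧
      IsIntOp p q k T ∧
      (∀ f : LpR p, (T f : ℝ → ℂ) =ᵐ[volume] fun x =>
        (h : ℝ → ℂ) x * ∫ y : ℝ, (φ : ℝ → ℂ) (x - y) * (f : ℝ → ℂ) y) ∧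
      T ∈ Gp p q ∧ T ∈ parabolicAlgebra p := by
  have : ENNReal.HolderConjugate q p := by
    rw [ENNReal.holderConjugate_iff, add_comm]
    simpa only [one_div] using hpq
  refine ⟨mulConvKernel p q hq' h φ, mulConvOp p q hq' h φ, coeFn_mulConvKernel p q hq' h φ,
    isIntOp_intOp p q _, coeFn_mulConvOp p q hq' h φ, ⟨_, isIntOp_intOp p q _⟩, ?_⟩
  rintro _ ⟨hgens, hA, A, rfl⟩
  let L : LpR p →L[ℂ] LpR p →L[ℂ] LpR p := (intOp p q).comp ((mulConvKernel p q hq').flip φ)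
  refine hardy_subset_of_isClosed (q := q) (V := A.toSubmodule.comap L.toLinearMap) hp hp' hq hq'
    (hA.isClosed.preimage L.continuous) (fun u m hu hm => ?_) hh
  have hb : MemLp (fun x : ℝ => ((x : ℂ) + u)⁻¹) ⊤ volume :=
    memLp_top_of_bound (continuous_inv_add hu).aestronglyMeasurable _
      (.of_forall (norm_inv_add_le hu))
  refine mulConvOp_mem_of_isMulOp hgens hA hp' hq' (M := mulOp p hb.toLp) (fun f => ?_)
    (isMulOp_inv_add_mem q hgens hA hp' hu (isMulOp_mulOp p hb)) hφ
  filter_upwards [isMulOp_mulOp p hb f, hm] with x h1 h2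
  rw [h1, h2]

end
end

section
/- For every p ∈ (1,∞), the linear span of the set {b_u : u ∈ ℍ⁺} is dense in H^p(ℝ). -/
open MeasureTheory Complex Filter Topology
open scoped ENNReal NNReal

noncomputable section

theorem norm_one_div_add_le {u : ℂ} (hu : 0 < u.im) (x : ℝ) :
    ‖1 / ((x : ℂ) + u)‖ ≤ (1 + (1 + ‖u‖) / u.im) * (1 + ‖x‖) ^ (-1 : ℝ) := by
  have him : u.im ≤ ‖(x : ℂ) + u‖ := by
    simpa using (le_abs_self _).trans (Complex.abs_im_le_norm ((x : ℂ) + u))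
  have hx : ‖x‖ ≤ ‖(x : ℂ) + u‖ + ‖u‖ := by
    simpa using norm_sub_le ((x : ℂ) + u) u
  have hpos : 0 < ‖(x : ℂ) + u‖ := hu.trans_le him
  rw [norm_div, norm_one, Real.rpow_neg_one, ← div_eq_mul_inv, div_le_div_iff₀ hpos (by positivity)]
  have : 1 + ‖u‖ ≤ (1 + ‖u‖) / u.im * ‖(x : ℂ) + u‖ := by
    rw [div_mul_eq_mul_div, le_div_iff₀ hu]
    gcongr
  linarith

theorem ofReal_add_ne_zero {u : ℂ} (hu : u.im ≠ 0) (x : ℝ) : (x : ℂ) + u ≠ 0 := fun h ↦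
  hu (by simpa using congrArg Complex.im h)

theorem continuous_one_div_add {u : ℂ} (hu : u.im ≠ 0) :
    Continuous fun x : ℝ ↦ 1 / ((x : ℂ) + u) :=
  continuous_const.div (by fun_prop) (ofReal_add_ne_zero hu)

theorem memLp_one_div_add {p : ℝ≥0∞} (hp : 1 < p) (hp' : p ≠ ∞) {u : ℂ} (hu : 0 < u.im) :
    MemLp (fun x : ℝ ↦ 1 / ((x : ℂ) + u)) p := by
  have hp1 : 1 < p.toReal := by
    simpa using (ENNReal.toReal_lt_toReal ENNReal.one_ne_top hp').2 hp
  have hmem : MemLp (fun x : ℝ ↦ (1 + ‖x‖) ^ (-1 : ℝ)) p := by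
    rw [← integrable_norm_rpow_iff (Measurable.aestronglyMeasurable (by fun_prop))
      (zero_lt_one.trans hp).ne' hp']
    refine (integrable_one_add_norm (μ := (volume : Measure ℝ)) (r := p.toReal)
      (by simpa using hp1)).congr (.of_forall fun x ↦ ?_)
    have : 0 < 1 + ‖x‖ := by positivity
    change (1 + ‖x‖) ^ (-p.toReal) = ‖(1 + ‖x‖) ^ (-1 : ℝ)‖ ^ p.toReal
    rw [Real.norm_of_nonneg (r := (1 + ‖x‖) ^ (-1 : ℝ)) (by positivity),
      ← Real.rpow_mul this.le, neg_one_mul]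
  refine (hmem.const_mul (1 + (1 + ‖u‖) / u.im)).mono
    (continuous_one_div_add hu.ne').aestronglyMeasurable (.of_forall fun x ↦ ?_)
  exact (norm_one_div_add_le hu x).trans (Real.le_norm_self _)

theorem tendsto_one_div_ofReal_add_cocompact (u : ℂ) :
    Tendsto (fun x : ℝ ↦ 1 / ((x : ℂ) + u)) (cocompact ℝ) (𝓝 0) := by
  simp only [one_div]
  refine tendsto_inv₀_cobounded.comp ?_
  rw [← tendsto_norm_atTop_iff_cobounded]
  have h : Tendsto (fun x : ℝ ↦ ‖x‖ - ‖u‖) (cocompact ℝ) atTop :=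
    tendsto_atTop_add_const_right _ _ (tendsto_norm_cocompact_atTop (E := ℝ))
  refine tendsto_atTop_mono (fun x ↦ ?_) h
  simpa using norm_sub_norm_le (x : ℂ) (-u)

theorem integral_one_div_add_mul_one_div_add {u v : ℂ} (hu : 0 < u.im) (hv : 0 < v.im) :
    ∫ x : ℝ, 1 / ((x : ℂ) + u) * (1 / ((x : ℂ) + v)) = 0 := by
  have hint : Integrable fun x : ℝ ↦ 1 / ((x : ℂ) + u) * (1 / ((x : ℂ) + v)) :=
    (memLp_one_div_add ENNReal.one_lt_two ENNReal.ofNat_ne_top hu).integrable_mul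
      (memLp_one_div_add ENNReal.one_lt_two ENNReal.ofNat_ne_top hv)
  have hu0 := ofReal_add_ne_zero hu.ne'
  have hv0 := ofReal_add_ne_zero hv.ne'
  have hderiv (w : ℂ) (x : ℝ) : HasDerivAt (fun x : ℝ ↦ (x : ℂ) + w) 1 x :=
    (hasDerivAt_id x).ofReal_comp.add_const w
  rcases eq_or_ne u v with rfl | huv
  · have hlim : Tendsto (fun x : ℝ ↦ -((x : ℂ) + u)⁻¹) (cocompact ℝ) (𝓝 0) := by
      simpa using (tendsto_one_div_ofReal_add_cocompact u).neg
    rw [integral_of_hasDerivAt_of_tendsto (f := fun x : ℝ ↦ -((x : ℂ) + u)⁻¹) (fun x ↦ ?_) hint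
      (hlim.mono_left atBot_le_cocompact) (hlim.mono_left atTop_le_cocompact), sub_zero]
    refine ((hderiv u x).fun_inv (hu0 x)).neg.congr_deriv ?_
    have := hu0 x
    field_simp
  · have hlim : Tendsto (fun x : ℝ ↦ (v - u)⁻¹ * Complex.log (((x : ℂ) + u) / ((x : ℂ) + v)))
        (cocompact ℝ) (𝓝 0) := by
      have h1 : Tendsto (fun x : ℝ ↦ ((x : ℂ) + u) / ((x : ℂ) + v)) (cocompact ℝ) (𝓝 1) := by
        have := ((tendsto_one_div_ofReal_add_cocompact v).const_mul (u - v)).const_add 1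
        rw [mul_zero, add_zero] at this
        refine this.congr fun x ↦ ?_
        field_simp [hv0 x]
        ring
      simpa using ((continuousAt_clog (x := 1) (by simp)).tendsto.comp h1).const_mul (v - u)⁻¹
    rw [integral_of_hasDerivAt_of_tendsto
      (f := fun x : ℝ ↦ (v - u)⁻¹ * Complex.log (((x : ℂ) + u) / ((x : ℂ) + v))) (fun x ↦ ?_) hint
      (hlim.mono_left atBot_le_cocompact) (hlim.mono_left atTop_le_cocompact), sub_zero]
    have hslit : ((x : ℂ) + u) / ((x : ℂ) + v) ∈ slitPlane := by
      rw [mem_slitPlane_iff_not_le_zero]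
      intro hle
      obtain ⟨hre, him⟩ := Complex.le_def.1 hle
      set z := ((x : ℂ) + u) / ((x : ℂ) + v) with hz
      have hmul : (x : ℂ) + u = z * ((x : ℂ) + v) := (div_mul_cancel₀ _ (hv0 x)).symm
      have := congrArg Complex.im hmul
      simp only [add_im, ofReal_im, zero_add, mul_im, him, zero_im, zero_mul, add_zero] at this
      have h2 : z.re ≤ 0 := by simpa using hre
      nlinarith
    refine ((((hderiv u x).fun_div (hderiv v x) (hv0 x)).clog_real hslit).const_mul
      (v - u)⁻¹).congr_deriv ?_
    have hu0x := hu0 x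
    have hv0x := hv0 x
    have : v - u ≠ 0 := sub_ne_zero.2 huv.symm
    field_simp
    ring

theorem integral_mem_of_isClosed {α E : Type*} [MeasurableSpace α] {ν : Measure α}
    [NormedAddCommGroup E] [NormedSpace ℂ E] [CompleteSpace E] {S : Submodule ℂ E}
    (hS : IsClosed (S : Set E)) {F : α → E} (hF : Integrable F ν) (hFS : ∀ t, F t ∈ S) :
    ∫ t, F t ∂ν ∈ S := by
  have : IsClosed (S : Set E) := hS
  have h := S.mkQL.integral_comp_comm hF
  have h0 (t : α) : S.mkQL (F t) = 0 := by simpa using hFS t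
  simp only [h0, integral_zero] at h
  simpa using h.symm

theorem exists_holderConjugate {p : ℝ≥0∞} (hp : 1 < p) (hp' : p ≠ ∞) :
    ∃ q : ℝ≥0∞, ENNReal.HolderConjugate p q ∧ 1 < q ∧ q ≠ ∞ := by
  have h : ENNReal.HolderConjugate p (1 - p⁻¹)⁻¹ := by
    rw [ENNReal.holderConjugate_iff, inv_inv]
    exact add_tsub_cancel_of_le (ENNReal.inv_le_one.2 hp.le)
  exact ⟨_, h, (ENNReal.HolderConjugate.lt_top_iff_one_lt p _).1 hp'.lt_top,
    (ENNReal.HolderConjugate.ne_top_iff_ne_one _ p).2 hp.ne'⟩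

theorem tendsto_eLpNorm_of_dominated {α E : Type*} [MeasurableSpace α] {μ : Measure α}
    [NormedAddCommGroup E] {p : ℝ≥0∞} (hp : p ≠ 0) (hp' : p ≠ ∞) {F : ℕ → α → E} {g : α → E}
    (hF : ∀ n, AEStronglyMeasurable (F n) μ) (hg : MemLp g p μ)
    (hbound : ∀ n, ∀ᵐ x ∂μ, ‖F n x‖ₑ ≤ ‖g x‖ₑ)
    (hlim : ∀ᵐ x ∂μ, Tendsto (fun n ↦ F n x) atTop (𝓝 0)) :
    Tendsto (fun n ↦ eLpNorm (F n) p μ) atTop (𝓝 0) := by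
  have hp0 : 0 < p.toReal := ENNReal.toReal_pos hp hp'
  have h : Tendsto (fun n ↦ ∫⁻ x, ‖F n x‖ₑ ^ p.toReal ∂μ) atTop (𝓝 (∫⁻ _, 0 ∂μ)) := by
    refine tendsto_lintegral_of_dominated_convergence' (fun x ↦ ‖g x‖ₑ ^ p.toReal)
      (fun n ↦ (hF n).enorm.pow_const _)
      (fun n ↦ (hbound n).mono fun x hx ↦ ENNReal.rpow_le_rpow hx hp0.le)
      (lintegral_rpow_enorm_lt_top_of_eLpNorm_lt_top hp hp' hg.2).ne ?_
    filter_upwards [hlim] with x hx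
    have := ((ENNReal.continuous_rpow_const (y := p.toReal)).tendsto 0).comp
      (by simpa using hx.enorm : Tendsto (fun n ↦ ‖F n x‖ₑ) atTop (𝓝 0))
    simpa [ENNReal.zero_rpow_of_pos hp0, Function.comp_def] using this
  simp only [eLpNorm_eq_lintegral_rpow_enorm_toReal hp hp']
  have h2 := ((ENNReal.continuous_rpow_const (y := 1 / p.toReal)).tendsto _).comp h
  have h3 : 0 < 1 / p.toReal := by positivity
  rwa [lintegral_zero, ENNReal.zero_rpow_of_pos h3] at h2

/-- The Bochner integral of an `L^p`-valued function is computed pointwise. -/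
theorem coeFn_integral_Lp {α β : Type*} [MeasurableSpace α] [MeasurableSpace β]
    {ν : Measure α} {μ : Measure β} [SFinite ν] [SigmaFinite μ] {p : ℝ≥0∞} [Fact (1 ≤ p)]
    {F : α → Lp ℂ p μ} (hF : Integrable F ν) {k : α → β → ℂ}
    (hk : AEStronglyMeasurable (Function.uncurry k) (ν.prod μ)) (hFk : ∀ t, F t =ᵐ[μ] k t) :
    (∫ t, F t ∂ν : Lp ℂ p μ) =ᵐ[μ] fun x ↦ ∫ t, k t x ∂ν := by
  have : ENNReal.HolderConjugate p (1 - p⁻¹)⁻¹ := by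
    rw [ENNReal.holderConjugate_iff, inv_inv]
    exact add_tsub_cancel_of_le (ENNReal.inv_le_one.2 Fact.out)
  set q : ℝ≥0∞ := (1 - p⁻¹)⁻¹
  have : Fact (1 ≤ q) := ⟨ENNReal.HolderConjugate.one_le q p⟩
  have hint (s : Set β) (hs : μ s < ∞) (f : Lp ℂ p μ) : IntegrableOn f s μ := by
    have : IsFiniteMeasure (μ.restrict s) := ⟨by simpa using hs⟩
    exact ((Lp.memLp f).restrict s).integrable Fact.out
  have hprod (s : Set β) (hms : MeasurableSet s) (hs : μ s < ∞) :
      Integrable (Function.uncurry k) (ν.prod (μ.restrict s)) := by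
    have : IsFiniteMeasure (μ.restrict s) := ⟨by simpa using hs⟩
    have hk' : AEStronglyMeasurable (Function.uncurry k) (ν.prod (μ.restrict s)) :=
      hk.mono_ac (Measure.AbsolutelyContinuous.rfl.prod Measure.restrict_le_self.absolutelyContinuous)
    refine (integrable_prod_iff hk').2 ⟨.of_forall fun t ↦
      (hint s hs (F t)).congr (ae_restrict_of_ae (hFk t)), ?_⟩
    obtain ⟨C, hC⟩ : ∃ C : ℝ, ∀ f : Lp ℂ p μ, ∫ x in s, ‖f x‖ ∂μ ≤ C * ‖f‖ := by
      refine ⟨(μ.restrict s Set.univ ^ (1 / (1 : ℝ≥0∞).toReal - 1 / p.toReal)).toReal,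
        fun f ↦ ?_⟩
      have h1 := eLpNorm_le_eLpNorm_mul_rpow_measure_univ (μ := μ.restrict s)
        (Fact.out : 1 ≤ p) ((Lp.memLp f).restrict s).1
      rw [integral_norm_eq_lintegral_enorm (hint s hs f).1, ← eLpNorm_one_eq_lintegral_enorm,
        Lp.norm_def, mul_comm, ← ENNReal.toReal_mul]
      refine ENNReal.toReal_mono (ENNReal.mul_ne_top (Lp.eLpNorm_ne_top f) ?_)
        (h1.trans (by gcongr; exact Measure.restrict_le_self))
      refine (ENNReal.rpow_lt_top_of_nonneg ?_ (measure_ne_top _ _)).ne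
      rcases eq_or_ne p ∞ with rfl | hp
      · simp
      · have : 1 ≤ p.toReal := by
          simpa using (ENNReal.toReal_le_toReal ENNReal.one_ne_top hp).2 Fact.out
        simpa using inv_le_one_of_one_le₀ this
    refine (hF.norm.const_mul C).mono' hk'.norm.integral_prod_right' (.of_forall fun t ↦ ?_)
    rw [Real.norm_of_nonneg (integral_nonneg fun _ ↦ norm_nonneg _)]
    refine (integral_congr_ae (ae_restrict_of_ae ?_)).trans_le (hC (F t))
    filter_upwards [hFk t] with x hx
    simp [hx]
  refine ae_eq_of_forall_setIntegral_eq_of_sigmaFinite (fun s _ hs ↦ hint s hs _)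
    (fun s hms hs ↦ (hprod s hms hs).integral_prod_right) fun s hms hs ↦ ?_
  let φ : Lp ℂ q μ := indicatorConstLp q hms hs.ne 1
  let L : Lp ℂ p μ →L[ℂ] ℂ := ((ContinuousLinearMap.mul ℂ ℂ).lpPairing μ p q).flip φ
  have hL (f : Lp ℂ p μ) : L f = ∫ x in s, f x ∂μ := by
    simp only [L, ContinuousLinearMap.flip_apply, ContinuousLinearMap.lpPairing_eq_integral]
    rw [← integral_indicator hms]
    refine integral_congr_ae ?_
    filter_upwards [indicatorConstLp_coeFn (p := q) (hs := hms) (hμs := hs.ne) (c := (1 : ℂ))]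
      with x hx
    by_cases hxs : x ∈ s <;> simp [φ, hx, hxs]
  rw [← hL, ← L.integral_comp_comm hF, ← integral_integral_swap (f := k) (hprod s hms hs)]
  refine integral_congr_ae (.of_forall fun t ↦ ?_)
  simp only [hL]
  exact integral_congr_ae (ae_restrict_of_ae (hFk t))

theorem integrable_poisson : Integrable fun s : ℝ ↦ Real.pi⁻¹ * (1 + s ^ 2)⁻¹ :=
  integrable_inv_one_add_sq.const_mul _

theorem integrable_smul_translate {p : ℝ≥0∞} [Fact (1 ≤ p)] [Fact (p ≠ ∞)]
    {𝕜 : Type*} [RCLike 𝕜] [NormedSpace 𝕜 ℂ] {φ : ℝ → 𝕜} (hφ : Integrable φ)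
    {c : ℝ → ℝ} (hc : Continuous c) (g : Lp ℂ p (volume : Measure ℝ)) :
    Integrable fun s ↦ φ s • (DomAddAct.mk (c s) +ᵥ g) := by
  have hcont : Continuous fun s ↦ DomAddAct.mk (c s) +ᵥ g :=
    (DomAddAct.continuous_mk.comp hc).vadd continuous_const
  refine (hφ.norm.mul_const ‖g‖).mono' (hφ.1.smul hcont.aestronglyMeasurable)
    (.of_forall fun s ↦ ?_)
  rw [norm_smul, DomAddAct.norm_vadd_Lp]

theorem tendsto_integral_poisson_smul_translate {p : ℝ≥0∞} [Fact (1 ≤ p)] [Fact (p ≠ ∞)]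
    (g : Lp ℂ p (volume : Measure ℝ)) :
    Tendsto (fun ε : ℝ ↦ ∫ s : ℝ,
      (Real.pi⁻¹ * (1 + s ^ 2)⁻¹) • (DomAddAct.mk (-(ε * s)) +ᵥ g)) (𝓝 0) (𝓝 g) := by
  have hone : ∫ s : ℝ, (Real.pi⁻¹ * (1 + s ^ 2)⁻¹) • g = g := by
    rw [integral_smul_const, integral_const_mul, integral_univ_inv_one_add_sq,
      inv_mul_cancel₀ Real.pi_ne_zero, one_smul]
  nth_rewrite 2 [← hone]
  refine tendsto_integral_filter_of_dominated_convergence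
    (fun s ↦ ‖Real.pi⁻¹ * (1 + s ^ 2)⁻¹‖ * ‖g‖) (.of_forall fun ε ↦
      (integrable_smul_translate integrable_poisson (c := fun s ↦ -(ε * s))
        (by fun_prop) g).aestronglyMeasurable)
    (.of_forall fun ε ↦ .of_forall fun s ↦ ?_) (integrable_poisson.norm.mul_const _)
    (.of_forall fun s ↦ ?_)
  · rw [norm_smul, DomAddAct.norm_vadd_Lp]
  · have hcont : Continuous fun ε : ℝ ↦ DomAddAct.mk (-(ε * s)) +ᵥ g :=
      (DomAddAct.continuous_mk.comp
        (by fun_prop : Continuous fun ε : ℝ ↦ -(ε * s))).vadd continuous_const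
    have h := (hcont.tendsto 0).const_smul (Real.pi⁻¹ * (1 + s ^ 2)⁻¹)
    simpa using h

theorem translate_toLp_one_div_add {p : ℝ≥0∞} [Fact (1 ≤ p)] (hp : 1 < p) (hp' : p ≠ ∞) {u : ℂ}
    (hu : 0 < u.im) (t : ℝ) (hut : 0 < (u - t).im) :
    DomAddAct.mk (-t) +ᵥ (memLp_one_div_add hp hp' hu).toLp =
      (memLp_one_div_add hp hp' hut).toLp := by
  rw [DomAddAct.mk_vadd_toLp]
  congr 1
  ext x
  simp
  ring

theorem integral_poisson_eq_cauchy {g : ℝ → ℂ} (hg : Integrable g) {ε : ℝ} (hε : 0 < ε) (x : ℝ)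
    (h0 : ∫ t : ℝ, g t / ((t : ℂ) + (-x + ε * I)) = 0) :
    ∫ s : ℝ, (Real.pi⁻¹ * (1 + s ^ 2)⁻¹) • g (-(ε * s) + x) =
      I / (2 * Real.pi) * ∫ t : ℝ, g t * (1 / (((-t + x : ℝ) : ℂ) + ε * I)) := by
  have hεim : (-(x : ℂ) + ε * I).im ≠ 0 := by simpa using hε.ne'
  have hεim' : (ε * I : ℂ).im ≠ 0 := by simpa using hε.ne'
  have hbdd {w : ℂ} (hw : w.im = ε) (y : ℝ) : ‖1 / ((y : ℂ) + w)‖ ≤ ε⁻¹ := by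
    rw [norm_div, norm_one, one_div]
    refine inv_anti₀ hε ?_
    simpa [hw] using (le_abs_self _).trans (Complex.abs_im_le_norm ((y : ℂ) + w))
  have hint1 : Integrable fun t : ℝ ↦ g t * (1 / (((-t + x : ℝ) : ℂ) + ε * I)) :=
    hg.mul_bdd (c := ε⁻¹) ((continuous_one_div_add hεim').comp (by fun_prop)).aestronglyMeasurable
      (.of_forall fun t ↦ hbdd (by simp) _)
  have hint2 : Integrable fun t : ℝ ↦ g t * (1 / ((t : ℂ) + (-x + ε * I))) :=
    hg.mul_bdd (c := ε⁻¹) (continuous_one_div_add hεim).aestronglyMeasurable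
      (.of_forall fun t ↦ hbdd (by simp) _)
  have hsubst : ∫ s : ℝ, (Real.pi⁻¹ * (1 + s ^ 2)⁻¹) • g (-(ε * s) + x) =
      ∫ t : ℝ, ε⁻¹ • (Real.pi⁻¹ * (1 + ((x - t) / ε) ^ 2)⁻¹) • g t := by
    rw [integral_smul]
    have h1 := Measure.integral_comp_mul_left
      (fun t ↦ (Real.pi⁻¹ * (1 + (t / ε) ^ 2)⁻¹) • g (x - t)) ε
    rw [abs_of_pos (inv_pos.2 hε)] at h1
    have h2 := integral_sub_left_eq_self
      (fun t ↦ (Real.pi⁻¹ * (1 + ((x - t) / ε) ^ 2)⁻¹) • g t) volume x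
    simp only [sub_sub_cancel] at h2
    rw [← h2, ← h1]
    refine integral_congr_ae (.of_forall fun s ↦ ?_)
    simp only [mul_div_cancel_left₀ s hε.ne', neg_add_eq_sub]
  have h0' : ∫ t : ℝ, g t * (1 / ((t : ℂ) + (-x + ε * I))) = 0 := by
    simpa only [mul_one_div] using h0
  rw [hsubst, ← add_zero (∫ t : ℝ, g t * _), ← h0', ← integral_add hint1 hint2,
    ← integral_const_mul]
  refine integral_congr_ae (.of_forall fun t ↦ ?_)
  have hn1 : (-(t : ℂ) + x + ε * I) ≠ 0 := by
    simpa using ofReal_add_ne_zero hεim' (-t + x)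
  have hn2 := ofReal_add_ne_zero hεim t
  have hn3 : (ε : ℂ) ^ 2 + (x - t) ^ 2 ≠ 0 := by
    exact_mod_cast (by positivity : ε ^ 2 + (x - t) ^ 2 ≠ 0)
  have hε0 : (ε : ℂ) ≠ 0 := by exact_mod_cast hε.ne'
  have hπ : (Real.pi : ℂ) ≠ 0 := by exact_mod_cast Real.pi_ne_zero
  have hprod : (-(t : ℂ) + x + ε * I) * ((t : ℂ) + (-x + ε * I)) = -(ε ^ 2 + (x - t) ^ 2) := by
    linear_combination (ε ^ 2 : ℂ) * I_sq
  have hsum : 1 / (-(t : ℂ) + x + ε * I) + 1 / ((t : ℂ) + (-x + ε * I)) =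
      -(2 * ε * I) / (ε ^ 2 + (x - t) ^ 2) := by
    rw [div_add_div _ _ hn1 hn2, hprod, div_neg, neg_div]
    ring
  simp only [Complex.real_smul]
  push_cast
  rw [← mul_add, hsum]
  have hn4 : (1 : ℂ) + ((x - t) / ε) ^ 2 = (ε ^ 2 + (x - t) ^ 2) / ε ^ 2 := by
    field_simp
  rw [hn4]
  field_simp
  linear_combination g t * I_sq

theorem integral_poisson_smul_translate_mem {p : ℝ≥0∞} [Fact (1 ≤ p)] (hp : 1 < p) (hp' : p ≠ ∞)
    {S : Submodule ℂ (Lp ℂ p (volume : Measure ℝ))}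
    (hS : IsClosed (S : Set (Lp ℂ p (volume : Measure ℝ))))
    (hSb : ∀ u : ℂ, ∀ hu : 0 < u.im, (memLp_one_div_add hp hp' hu).toLp ∈ S)
    {g : Lp ℂ p (volume : Measure ℝ)} (hg : Integrable g) {ε : ℝ} (hε : 0 < ε)
    (h0 : ∀ u : ℂ, u.im = ε → ∫ t : ℝ, g t / ((t : ℂ) + u) = 0) :
    ∫ s : ℝ, (Real.pi⁻¹ * (1 + s ^ 2)⁻¹) • (DomAddAct.mk (-(ε * s)) +ᵥ g) ∈ S := by
  have : Fact (p ≠ ∞) := ⟨hp'⟩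
  have hεim : 0 < (ε * I : ℂ).im := by simpa using hε
  set b : Lp ℂ p (volume : Measure ℝ) := (memLp_one_div_add hp hp' hεim).toLp with hb
  have htrans (c : ℝ) (f : Lp ℂ p (volume : Measure ℝ)) :
      (DomAddAct.mk c +ᵥ f : Lp ℂ p (volume : Measure ℝ)) =ᵐ[volume] fun x ↦ f (c + x) :=
    DomAddAct.vadd_Lp_ae_eq _ _
  have hintb : Integrable fun t : ℝ ↦ g t • (DomAddAct.mk (-t) +ᵥ b) :=
    integrable_smul_translate hg (by fun_prop) b
  have hA := coeFn_integral_Lp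
    (integrable_smul_translate integrable_poisson (c := fun s ↦ -(ε * s)) (by fun_prop) g)
    (k := fun s x ↦ (Real.pi⁻¹ * (1 + s ^ 2)⁻¹) • g (-(ε * s) + x)) ?_ fun s ↦ ?_
  rotate_left
  · exact (((by fun_prop : Measurable fun z : ℝ × ℝ ↦
      Real.pi⁻¹ * (1 + z.1 ^ 2)⁻¹).stronglyMeasurable).smul
        ((Lp.stronglyMeasurable g).comp_measurable
          (by fun_prop : Measurable fun z : ℝ × ℝ ↦ -(ε * z.1) + z.2))).aestronglyMeasurable
  · filter_upwards [htrans (-(ε * s)) g, Lp.coeFn_smul (Real.pi⁻¹ * (1 + s ^ 2)⁻¹)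
      (DomAddAct.mk (-(ε * s)) +ᵥ g)] with x h1 h2
    rw [h2, Pi.smul_apply, h1]
  have hB := coeFn_integral_Lp hintb
    (k := fun t x ↦ g t * (1 / (((-t + x : ℝ) : ℂ) + ε * I))) ?_ fun t ↦ ?_
  rotate_left
  · exact (StronglyMeasurable.mul ((Lp.stronglyMeasurable g).comp_measurable measurable_fst)
      ((continuous_one_div_add hεim.ne').comp
        (by fun_prop : Continuous fun z : ℝ × ℝ ↦ -z.1 + z.2)).stronglyMeasurable).aestronglyMeasurable
  · have hbt : (DomAddAct.mk (-t) +ᵥ b : Lp ℂ p (volume : Measure ℝ)) =ᵐ[volume]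
        fun x ↦ 1 / (((-t + x : ℝ) : ℂ) + ε * I) := by
      rw [hb, DomAddAct.mk_vadd_toLp]
      exact MemLp.coeFn_toLp _
    filter_upwards [hbt, Lp.coeFn_smul (g t) (DomAddAct.mk (-t) +ᵥ b)] with x h1 h2
    rw [h2, Pi.smul_apply, h1, smul_eq_mul]
  have heq : ∫ s : ℝ, (Real.pi⁻¹ * (1 + s ^ 2)⁻¹) • (DomAddAct.mk (-(ε * s)) +ᵥ g) =
      (I / (2 * Real.pi)) • ∫ t : ℝ, g t • (DomAddAct.mk (-t) +ᵥ b) := by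
    refine Lp.ext ?_
    filter_upwards [hA, hB, Lp.coeFn_smul (I / (2 * Real.pi))
      (∫ t : ℝ, g t • (DomAddAct.mk (-t) +ᵥ b))] with x h1 h2 h3
    rw [h1, h3, Pi.smul_apply, h2, smul_eq_mul]
    exact integral_poisson_eq_cauchy hg hε x (h0 _ (by simp))
  rw [heq]
  refine S.smul_mem _ (integral_mem_of_isClosed hS hintb fun t ↦ S.smul_mem _ ?_)
  have hut : 0 < ((ε * I : ℂ) - t).im := by simpa using hε
  rw [hb, translate_toLp_one_div_add hp hp' hεim t hut]
  exact hSb _ hut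


theorem mem_of_integrable_of_integral_div_eq_zero_s8 {p : ℝ≥0∞} [Fact (1 ≤ p)] (hp : 1 < p)
    (hp' : p ≠ ∞) {S : Submodule ℂ (Lp ℂ p (volume : Measure ℝ))}
    (hS : IsClosed (S : Set (Lp ℂ p (volume : Measure ℝ))))
    (hSb : ∀ u : ℂ, ∀ hu : 0 < u.im, (memLp_one_div_add hp hp' hu).toLp ∈ S)
    {g : Lp ℂ p (volume : Measure ℝ)} (hg : Integrable g)
    (h0 : ∀ u : ℂ, 0 < u.im → u.im < 1 → ∫ t : ℝ, g t / ((t : ℂ) + u) = 0) : g ∈ S := by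
  have : Fact (p ≠ ∞) := ⟨hp'⟩
  refine hS.mem_of_tendsto
    ((tendsto_integral_poisson_smul_translate g).mono_left (nhdsWithin_le_nhds (s := Set.Ioi 0))) ?_
  filter_upwards [Ioo_mem_nhdsGT (zero_lt_one' ℝ)] with ε hε
  exact integral_poisson_smul_translate_mem hp hp' hS hSb hg hε.1
    fun u hu ↦ h0 u (hu ▸ hε.1) (hu ▸ hε.2)

theorem integrable_mul_one_div_add {p : ℝ≥0∞} (hp : 1 < p) (hp' : p ≠ ∞) {f : ℝ → ℂ}
    (hf : MemLp f p) {u : ℂ} (hu : 0 < u.im) : Integrable fun x : ℝ ↦ f x * (1 / ((x : ℂ) + u)) := by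
  obtain ⟨q, hpq, hq, hq'⟩ := exists_holderConjugate hp hp'
  exact hf.integrable_mul (memLp_one_div_add hq hq' hu)

theorem integral_damped_div_eq_zero {p : ℝ≥0∞} (hp : 1 < p) (hp' : p ≠ ∞) {f : ℝ → ℂ}
    (hf : MemLp f p) (h0 : ∀ u : ℂ, 0 < u.im → ∫ x : ℝ, f x / ((x : ℂ) + u) = 0) {u w : ℂ}
    (hu : 0 < u.im) (hw : 0 < w.im) (huw : u ≠ w) :
    ∫ x : ℝ, f x * (w / ((x : ℂ) + w)) / ((x : ℂ) + u) = 0 := by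
  have hzero {v : ℂ} (hv : 0 < v.im) : ∫ x : ℝ, f x * (1 / ((x : ℂ) + v)) = 0 := by
    simpa only [mul_one_div] using h0 v hv
  have h := integral_const_mul (μ := volume) (w / (w - u)) fun x : ℝ ↦
    f x * (1 / ((x : ℂ) + u)) - f x * (1 / ((x : ℂ) + w))
  rw [integral_sub (integrable_mul_one_div_add hp hp' hf hu)
    (integrable_mul_one_div_add hp hp' hf hw), hzero hu, hzero hw, sub_zero, mul_zero] at h
  rw [← h]
  refine integral_congr_ae (.of_forall fun x ↦ ?_)
  have hu0 := ofReal_add_ne_zero hu.ne' x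
  have hw0 := ofReal_add_ne_zero hw.ne' x
  have : w - u ≠ 0 := sub_ne_zero.2 huw.symm
  field_simp
  ring

theorem norm_ofReal_le_norm_add_mul_I (x y : ℝ) : ‖(x : ℂ)‖ ≤ ‖(x : ℂ) + y * I‖ := by
  simpa using Complex.abs_re_le_norm ((x : ℂ) + y * I)

theorem norm_ofReal_mul_I_le_norm_add (x y : ℝ) : ‖(y * I : ℂ)‖ ≤ ‖(x : ℂ) + y * I‖ := by
  simpa using Complex.abs_im_le_norm ((x : ℂ) + y * I)

theorem tendsto_eLpNorm_damped_sub {p : ℝ≥0∞} (hp : p ≠ 0) (hp' : p ≠ ∞) {f : ℝ → ℂ}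
    (hf : MemLp f p) :
    Tendsto (fun n : ℕ ↦ eLpNorm ((fun x : ℝ ↦ f x *
      ((((n : ℝ) + 1 : ℝ) * I : ℂ) / ((x : ℂ) + ((n : ℝ) + 1 : ℝ) * I))) - f) p) atTop (𝓝 0) := by
  have him (n : ℕ) : (((n : ℝ) + 1 : ℝ) * I : ℂ).im ≠ 0 := by simpa using by positivity
  have heq (n : ℕ) (x : ℝ) : f x *
      ((((n : ℝ) + 1 : ℝ) * I : ℂ) / ((x : ℂ) + ((n : ℝ) + 1 : ℝ) * I)) - f x =
      f x * -(x / ((x : ℂ) + ((n : ℝ) + 1 : ℝ) * I)) := by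
    have := ofReal_add_ne_zero (him n) x
    field_simp
    ring
  refine tendsto_eLpNorm_of_dominated hp hp' (fun n ↦ ?_) hf (fun n ↦ .of_forall fun x ↦ ?_)
    (.of_forall fun x ↦ ?_)
  · refine (hf.1.mul (Continuous.aestronglyMeasurable ?_)).sub hf.1
    exact continuous_const.div (by fun_prop) (ofReal_add_ne_zero (him n))
  · rw [Pi.sub_apply, heq, enorm_le_iff_norm_le, norm_mul, norm_neg, norm_div]
    exact mul_le_of_le_one_right (norm_nonneg _)
      (div_le_one_of_le₀ (norm_ofReal_le_norm_add_mul_I _ _) (norm_nonneg _))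
  · simp only [Pi.sub_apply, heq]
    have hlim : Tendsto (fun n : ℕ ↦ (x : ℂ) / ((x : ℂ) + ((n : ℝ) + 1 : ℝ) * I)) atTop (𝓝 0) := by
      rw [tendsto_zero_iff_norm_tendsto_zero]
      have h1 : Tendsto (fun n : ℕ ↦ ‖(x : ℂ)‖ / ((n : ℝ) + 1)) atTop (𝓝 0) :=
        tendsto_const_nhds.div_atTop
          (tendsto_atTop_add_const_right _ _ tendsto_natCast_atTop_atTop)
      refine squeeze_zero (fun _ ↦ norm_nonneg _) (fun n ↦ ?_) h1
      rw [norm_div]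
      gcongr
      refine le_trans (le_of_eq ?_) (norm_ofReal_mul_I_le_norm_add x ((n : ℝ) + 1))
      rw [norm_mul, norm_I, mul_one, norm_real, Real.norm_of_nonneg (by positivity)]
    simpa using hlim.neg.const_mul (f x)

theorem mem_of_integral_div_eq_zero {p : ℝ≥0∞} [Fact (1 ≤ p)] (hp : 1 < p)
    (hp' : p ≠ ∞) {S : Submodule ℂ (Lp ℂ p (volume : Measure ℝ))}
    (hS : IsClosed (S : Set (Lp ℂ p (volume : Measure ℝ))))
    (hSb : ∀ u : ℂ, ∀ hu : 0 < u.im, (memLp_one_div_add hp hp' hu).toLp ∈ S)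
    {f : Lp ℂ p (volume : Measure ℝ)}
    (h0 : ∀ u : ℂ, 0 < u.im → ∫ t : ℝ, f t / ((t : ℂ) + u) = 0) : f ∈ S := by
  let w (n : ℕ) : ℂ := ((n : ℝ) + 1 : ℝ) * I
  have hwim (n : ℕ) : (w n).im = n + 1 := by simp [w]
  have hw (n : ℕ) : 0 < (w n).im := by rw [hwim]; positivity
  have hf := Lp.memLp f
  have hmeas (n : ℕ) : AEStronglyMeasurable (fun x : ℝ ↦ f x * (w n / ((x : ℂ) + w n))) :=
    hf.1.mul (continuous_const.div (by fun_prop)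
      (ofReal_add_ne_zero (hw n).ne')).aestronglyMeasurable
  have hmem (n : ℕ) : MemLp (fun x : ℝ ↦ f x * (w n / ((x : ℂ) + w n))) p := by
    refine hf.mono (hmeas n) (.of_forall fun x ↦ ?_)
    rw [norm_mul, norm_div]
    exact mul_le_of_le_one_right (norm_nonneg _)
      (div_le_one_of_le₀ (norm_ofReal_mul_I_le_norm_add _ _) (norm_nonneg _))
  have hlim : Tendsto (fun n ↦ (hmem n).toLp) atTop (𝓝 f) :=
    (Lp.tendsto_Lp_iff_tendsto_eLpNorm' _ _).2 <|
      (tendsto_eLpNorm_damped_sub (zero_lt_one.trans hp).ne' hp' hf).congr fun n ↦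
        eLpNorm_congr_ae ((hmem n).coeFn_toLp.symm.sub .rfl)
  refine hS.mem_of_tendsto hlim (.of_forall fun n ↦ ?_)
  refine mem_of_integrable_of_integral_div_eq_zero_s8 hp hp' hS hSb ?_ fun u hu hu1 ↦ ?_
  · refine ((integrable_mul_one_div_add hp hp' hf (hw n)).const_mul (w n)).congr ?_
    filter_upwards [(hmem n).coeFn_toLp] with x hx
    rw [hx]
    ring
  · have huw : u ≠ w n := by
      rintro rfl
      rw [hwim] at hu1
      linarith [(Nat.cast_nonneg n : (0 : ℝ) ≤ n)]
    rw [← integral_damped_div_eq_zero hp hp' hf h0 hu (hw n) huw]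
    refine integral_congr_ae ?_
    filter_upwards [(hmem n).coeFn_toLp] with x hx
    rw [hx]

theorem exists_clm_eq_integral_div {p : ℝ≥0∞} [Fact (1 ≤ p)] (hp : 1 < p) (hp' : p ≠ ∞) {u : ℂ}
    (hu : 0 < u.im) : ∃ L : Lp ℂ p (volume : Measure ℝ) →L[ℂ] ℂ,
      ∀ f, L f = ∫ x : ℝ, f x / ((x : ℂ) + u) := by
  obtain ⟨q, hpq, hq, hq'⟩ := exists_holderConjugate hp hp'
  have : Fact (1 ≤ q) := ⟨hq.le⟩
  refine ⟨((ContinuousLinearMap.mul ℂ ℂ).lpPairing volume p q).flip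
    (memLp_one_div_add hq hq' hu).toLp, fun f ↦ ?_⟩
  rw [ContinuousLinearMap.flip_apply, ContinuousLinearMap.lpPairing_eq_integral]
  refine integral_congr_ae ?_
  filter_upwards [(memLp_one_div_add hq hq' hu).coeFn_toLp] with x hx
  rw [hx, ContinuousLinearMap.mul_apply', mul_one_div]

/-- For every `p ∈ (1,∞)`, the linear span of `{b_u : u ∈ ℍ⁺}`, where
`b_u(x) = 1/(x+u)`, is dense in `H^p(ℝ)`. -/
theorem span_bu_dense_in_hardy
    (p : ℝ≥0∞) [Fact (1 ≤ p)] (hp : 1 < p) (hp' : p ≠ ⊤) :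
    closure ((Submodule.span ℂ {f : LpR p | ∃ u : ℂ, 0 < u.im ∧
        (f : ℝ → ℂ) =ᵐ[volume] fun x => 1 / ((x : ℂ) + u)} :
      Submodule ℂ (LpR p)) : Set (LpR p)) = hardy p := by
  apply subset_antisymm
  · intro f hf u hu
    obtain ⟨L, hL⟩ := exists_clm_eq_integral_div hp hp' hu
    have hker : IsClosed (L.ker : Set (LpR p)) := L.isClosed_ker
    rw [← hL]
    refine closure_minimal (t := (L.ker : Set (LpR p))) ?_ hker hf
    refine Submodule.span_le.2 ?_
    rintro g ⟨v, hv, hg⟩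
    rw [SetLike.mem_coe, LinearMap.mem_ker]
    refine (hL g).trans ?_
    rw [← integral_one_div_add_mul_one_div_add hv hu]
    refine integral_congr_ae ?_
    filter_upwards [hg] with x hx
    rw [hx, mul_one_div]
  · intro f hf
    rw [← Submodule.topologicalClosure_coe]
    refine mem_of_integral_div_eq_zero hp hp' (Submodule.isClosed_topologicalClosure _)
      (fun u hu ↦ Submodule.le_topologicalClosure _ (Submodule.subset_span ?_)) hf
    exact ⟨u, hu, MemLp.coeFn_toLp _⟩

end
end

section
/- For every p ∈ (1,∞), the linear span of the set {b_u·b_w : u, w ∈ ℍ⁺} of products of two such functions is dense in H^p(ℝ). -/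
open MeasureTheory Complex Filter Topology
open scoped ENNReal NNReal

noncomputable section

namespace HardySpan

/-- The function `b_u(x) = 1 / (x + u)`. -/
def kernel (u : ℂ) (x : ℝ) : ℂ := 1 / ((x : ℂ) + u)

lemma add_ne_zero_of_im_pos {u : ℂ} (hu : 0 < u.im) (x : ℝ) : (x : ℂ) + u ≠ 0 := by
  intro h
  have := congrArg Complex.im h
  simp at this
  exact hu.ne' this

lemma continuous_kernel {u : ℂ} (hu : 0 < u.im) : Continuous (kernel u) :=
  continuous_const.div (by fun_prop) (add_ne_zero_of_im_pos hu)

lemma norm_kernel_le {u : ℂ} (hu : 0 < u.im) (x : ℝ) :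
    ‖kernel u x‖ ≤ ((1 + ‖u‖) / u.im + 1) * ‖(1 + ‖x‖)⁻¹‖ := by
  have h1 : u.im ≤ ‖(x : ℂ) + u‖ := by simpa using Complex.im_le_norm ((x : ℂ) + u)
  have h2 : ‖x‖ ≤ ‖(x : ℂ) + u‖ + ‖u‖ := by simpa using norm_sub_le ((x : ℂ) + u) u
  have h3 : 1 + ‖u‖ ≤ (1 + ‖u‖) / u.im * ‖(x : ℂ) + u‖ := by
    rw [div_mul_eq_mul_div, le_div_iff₀ hu]
    gcongr
  have h0 : (0 : ℝ) < 1 + ‖x‖ := by positivity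
  rw [kernel, norm_div, norm_one, norm_inv, Real.norm_of_nonneg h0.le, ← div_eq_mul_inv,
    div_le_div_iff₀ (hu.trans_le h1) h0]
  linarith

lemma memLp_kernel {u : ℂ} (hu : 0 < u.im) {r : ℝ≥0∞} (hr : 1 < r) (hr' : r ≠ ⊤) :
    MemLp (kernel u) r := by
  have h1 : 1 < r.toReal := by
    simpa using (ENNReal.toReal_lt_toReal ENNReal.one_ne_top hr').2 hr
  have h : MemLp (fun x : ℝ => (1 + ‖x‖)⁻¹) r := by
    have hm : Continuous fun x : ℝ => (1 + ‖x‖)⁻¹ :=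
      Continuous.inv₀ (by fun_prop) fun x => by positivity
    rw [← integrable_norm_rpow_iff hm.aestronglyMeasurable (zero_lt_one.trans hr).ne' hr']
    have := integrable_one_add_norm (E := ℝ) (μ := volume) (r := r.toReal) (by simpa using h1)
    refine this.congr (ae_of_all _ fun x => ?_)
    have h0 : (0 : ℝ) ≤ 1 + ‖x‖ := by positivity
    simp only
    rw [norm_inv, Real.norm_of_nonneg h0, Real.inv_rpow h0, Real.rpow_neg h0]
  exact h.of_le_mul (continuous_kernel hu).aestronglyMeasurable
    (ae_of_all _ (norm_kernel_le hu))

lemma tendsto_kernel_zero (u : ℂ) : Tendsto (kernel u) (cocompact ℝ) (𝓝 0) := by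
  have h : Tendsto (fun x : ℝ => (x : ℂ) + u) (cocompact ℝ) (cocompact ℂ) :=
    ((Homeomorph.addRight u).isClosedEmbedding.tendsto_cocompact).comp
      Complex.isometry_ofReal.isClosedEmbedding.tendsto_cocompact
  rw [← Metric.cobounded_eq_cocompact (α := ℂ)] at h
  exact (tendsto_inv₀_cobounded.comp h).congr fun x => by simp [kernel]

lemma hasDerivAt_kernel {u : ℂ} (hu : 0 < u.im) (x : ℝ) :
    HasDerivAt (kernel u) (-(kernel u x * kernel u x)) x := by
  have h := ((hasDerivAt_id x).ofReal_comp.add_const u).inv (add_ne_zero_of_im_pos hu x)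
  refine (h.congr_deriv ?_).congr_of_eventuallyEq (Eventually.of_forall fun y => ?_)
  · simp [kernel, div_eq_mul_inv, sq]
  · simp [kernel]

lemma integrable_kernel_mul {u v : ℂ} (hu : 0 < u.im) (hv : 0 < v.im) :
    Integrable fun x => kernel u x * kernel v x :=
  (memLp_kernel hu (r := 2) (by norm_num) (by simp)).integrable_mul
    (memLp_kernel hv (r := 2) (by norm_num) (by simp))

lemma kernel_sub_kernel {u v : ℂ} (hu : 0 < u.im) (hv : 0 < v.im) (x : ℝ) :
    kernel u x - kernel v x = (v - u) * (kernel u x * kernel v x) := by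
  have := add_ne_zero_of_im_pos hu x
  have := add_ne_zero_of_im_pos hv x
  simp only [kernel]
  field_simp
  ring

lemma integral_kernel_mul {u v : ℂ} (hu : 0 < u.im) (hv : 0 < v.im) :
    ∫ x, kernel u x * kernel v x = 0 := by
  rcases eq_or_ne u v with rfl | huv
  · have h := integral_of_hasDerivAt_of_tendsto (hasDerivAt_kernel hu)
      (integrable_kernel_mul hu hu).neg
      ((tendsto_kernel_zero u).mono_left (by rw [cocompact_eq_atBot_atTop]; exact le_sup_left))
      ((tendsto_kernel_zero u).mono_left (by rw [cocompact_eq_atBot_atTop]; exact le_sup_right))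
    simpa [integral_neg] using h
  · have hq : ∀ x : ℝ, ((x : ℂ) + u) / (x + v) ∈ slitPlane := by
      intro x
      rw [Complex.mem_slitPlane_iff_not_le_zero]
      intro h
      obtain ⟨r, hr, hr'⟩ : ∃ r : ℝ, r ≤ 0 ∧ ((x : ℂ) + u) / (x + v) = r := by
        rw [Complex.le_def] at h
        exact ⟨_, h.1, Complex.ext rfl (by simpa using h.2)⟩
      rw [div_eq_iff (add_ne_zero_of_im_pos hv x)] at hr'
      have := congrArg Complex.im hr'
      simp at this
      nlinarith
    have hd : ∀ x : ℝ, HasDerivAt (fun x : ℝ => Complex.log (((x : ℂ) + u) / (x + v)))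
        ((v - u) * (kernel u x * kernel v x)) x := by
      intro x
      have hu' := add_ne_zero_of_im_pos hu x
      have hv' := add_ne_zero_of_im_pos hv x
      have h := (((hasDerivAt_id x).ofReal_comp.add_const u).div
        ((hasDerivAt_id x).ofReal_comp.add_const v) hv').clog_real (hq x)
      refine h.congr_deriv ?_
      simp [kernel]
      field_simp
    have hlim : Tendsto (fun x : ℝ => Complex.log (((x : ℂ) + u) / (x + v)))
        (cocompact ℝ) (𝓝 0) := by
      have h1 : Tendsto (fun x : ℝ => ((x : ℂ) + u) / (x + v)) (cocompact ℝ) (𝓝 1) := by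
        have := ((tendsto_kernel_zero v).const_mul (u - v)).const_add 1
        simp only [mul_zero, add_zero] at this
        refine this.congr fun x => ?_
        have hv' := add_ne_zero_of_im_pos hv x
        simp only [kernel]
        field_simp
        ring
      simpa using h1.clog (by simp)
    have h := integral_of_hasDerivAt_of_tendsto hd
      ((integrable_kernel_mul hu hv).const_mul _)
      (hlim.mono_left (by rw [cocompact_eq_atBot_atTop]; exact le_sup_left))
      (hlim.mono_left (by rw [cocompact_eq_atBot_atTop]; exact le_sup_right))
    rw [integral_const_mul, sub_zero] at h
    exact (mul_eq_zero.1 h).resolve_left (sub_ne_zero.2 huv.symm)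

lemma integral_kernel_mul_mul_of_ne {u v w : ℂ} (hu : 0 < u.im) (hv : 0 < v.im) (hw : 0 < w.im)
    (h : v ≠ w) : ∫ x, kernel u x * (kernel v x * kernel w x) = 0 := by
  have h1 : ∀ x, kernel u x * (kernel v x * kernel w x) =
      (w - v)⁻¹ * (kernel u x * kernel v x - kernel u x * kernel w x) := by
    intro x
    rw [← mul_sub, kernel_sub_kernel hv hw]
    have := sub_ne_zero.2 h.symm
    field_simp
  simp_rw [h1]
  rw [integral_const_mul, integral_sub (integrable_kernel_mul hu hv) (integrable_kernel_mul hu hw),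
    integral_kernel_mul hu hv, integral_kernel_mul hu hw]
  simp

lemma norm_kernel_le_inv {u : ℂ} (hu : 0 < u.im) (x : ℝ) : ‖kernel u x‖ ≤ u.im⁻¹ := by
  have h1 : u.im ≤ ‖(x : ℂ) + u‖ := by simpa using Complex.im_le_norm ((x : ℂ) + u)
  rw [kernel, norm_div, norm_one, one_div]
  gcongr

lemma integral_kernel_mul_mul {u v w : ℂ} (hu : 0 < u.im) (hv : 0 < v.im) (hw : 0 < w.im) :
    ∫ x, kernel u x * (kernel v x * kernel w x) = 0 := by
  rcases eq_or_ne v w with rfl | h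
  · rcases eq_or_ne u v with rfl | h
    · have hi : Integrable fun x => kernel u x * (kernel u x * kernel u x) :=
        (integrable_kernel_mul hu hu).bdd_mul (continuous_kernel hu).aestronglyMeasurable
          (ae_of_all _ (norm_kernel_le_inv hu))
      have hd : ∀ x, HasDerivAt (fun x => kernel u x * kernel u x)
          (-2 * (kernel u x * (kernel u x * kernel u x))) x := fun x =>
        ((hasDerivAt_kernel hu x).mul (hasDerivAt_kernel hu x)).congr_deriv (by ring)
      have hl : Tendsto (fun x => kernel u x * kernel u x) (cocompact ℝ) (𝓝 0) := by
        simpa using (tendsto_kernel_zero u).mul (tendsto_kernel_zero u)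
      have h := integral_of_hasDerivAt_of_tendsto hd (hi.const_mul _)
        (hl.mono_left (by rw [cocompact_eq_atBot_atTop]; exact le_sup_left))
        (hl.mono_left (by rw [cocompact_eq_atBot_atTop]; exact le_sup_right))
      rw [integral_const_mul, sub_zero] at h
      simpa using h
    · rw [← integral_kernel_mul_mul_of_ne hv hu hv h]
      exact integral_congr_ae (ae_of_all _ fun x => by ring)
  · exact integral_kernel_mul_mul_of_ne hu hv hw h

section Translation

variable {p : ℝ≥0∞}

/-- The translate `x ↦ f (x - t)` of an element of `L^p(ℝ)`. -/
def translate (t : ℝ) (f : LpR p) : LpR p :=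
  Lp.compMeasurePreserving (fun x => x - t) (measurePreserving_sub_right volume t) f

lemma coeFn_translate (t : ℝ) (f : LpR p) : translate t f =ᵐ[volume] fun x => f (x - t) :=
  Lp.coeFn_compMeasurePreserving f _

@[simp]
lemma translate_zero (f : LpR p) : translate 0 f = f :=
  Lp.ext <| (coeFn_translate 0 f).trans <| by simp

@[simp]
lemma norm_translate (t : ℝ) (f : LpR p) : ‖translate t f‖ = ‖f‖ :=
  Lp.norm_compMeasurePreserving f _

variable [Fact (1 ≤ p)]

lemma continuous_translate (hp' : p ≠ ⊤) (f : LpR p) : Continuous fun t => translate t f := by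
  let g : C(ℝ, C(ℝ, ℝ)) := (ContinuousMap.mk (fun a : ℝ × ℝ => a.2 - a.1) (by fun_prop)).curry
  exact (continuous_const (y := f)).compMeasurePreservingLp g.continuous
    (fun t => measurePreserving_sub_right volume t) hp'

lemma integrable_smul_translate (hp' : p ≠ ⊤) {k : ℝ → ℂ} (hk : Integrable k) (f : LpR p) :
    Integrable fun t => k t • translate t f := by
  refine hk.smul_bdd ‖f‖ (continuous_translate hp' f).aestronglyMeasurable
    (ae_of_all _ fun t => (norm_translate t f).le)

lemma integrable_prod_mul_translate {k : ℝ → ℂ} (hk : Integrable k)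
    (f : LpR p) {s : Set ℝ} (hμs : volume s < ⊤) :
    Integrable (fun z : ℝ × ℝ => k z.2 * f (z.1 - z.2))
      ((volume.restrict s).prod volume) := by
  have hmeas : AEStronglyMeasurable (fun z : ℝ × ℝ => k z.2 * f (z.1 - z.2))
      ((volume.restrict s).prod volume) :=
    hk.1.comp_snd.mul
      ((Lp.stronglyMeasurable f).comp_measurable
        (measurable_fst.sub measurable_snd)).aestronglyMeasurable
  refine ⟨hmeas, ?_⟩
  rw [hasFiniteIntegral_iff_enorm, lintegral_prod_symm _ hmeas.enorm]
  set C : ℝ≥0∞ := eLpNorm f p volume * volume s ^ (1 / (1 : ℝ≥0∞).toReal - 1 / p.toReal)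
  have hCtop : C < ⊤ := by
    refine ENNReal.mul_lt_top (Lp.memLp f).2 (ENNReal.rpow_lt_top_of_nonneg ?_ hμs.ne)
    rcases eq_or_ne p ⊤ with rfl | hp'
    · simp
    · have h1 : 1 ≤ p.toReal := by
        simpa using (ENNReal.toReal_le_toReal ENNReal.one_ne_top hp').2 Fact.out
      simpa using inv_le_one_of_one_le₀ h1
  have hbound : ∀ t, ∫⁻ x in s, ‖k t * f (x - t)‖ₑ ≤ ‖k t‖ₑ * C := by
    intro t
    have hm : MemLp (fun x => f (x - t)) p :=
      (Lp.memLp f).comp_measurePreserving (measurePreserving_sub_right volume t)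
    simp_rw [enorm_mul]
    rw [lintegral_const_mul' _ _ enorm_ne_top]
    refine mul_le_mul_right ?_ _
    rw [← eLpNorm_one_eq_lintegral_enorm]
    refine (eLpNorm_le_eLpNorm_mul_rpow_measure_univ (Fact.out : 1 ≤ p) hm.1.restrict).trans ?_
    rw [Measure.restrict_apply_univ]
    refine mul_le_mul' ?_ le_rfl
    exact (eLpNorm_restrict_le _ _ _ _).trans_eq
      (eLpNorm_comp_measurePreserving (Lp.memLp f).1 (measurePreserving_sub_right volume t))
  refine (lintegral_mono hbound).trans_lt ?_
  rw [lintegral_mul_const' _ _ hCtop.ne]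
  exact ENNReal.mul_lt_top hk.2 hCtop

/-- The integral over a set of finite measure, as a continuous linear functional on `L^p(ℝ)`. -/
lemma exists_setIntegral_clm {s : Set ℝ} (hs : MeasurableSet s) (hμs : volume s < ⊤) :
    ∃ L : LpR p →L[ℂ] ℂ, ∀ f : LpR p, L f = ∫ x in s, f x := by
  let q := ENNReal.conjExponent p
  have : Fact (1 ≤ q) := ⟨ENNReal.HolderConjugate.one_le q p⟩
  refine ⟨((ContinuousLinearMap.mul ℂ ℂ).lpPairing volume p q).flip
    (indicatorConstLp q hs hμs.ne 1), fun f => ?_⟩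
  rw [ContinuousLinearMap.flip_apply, ContinuousLinearMap.lpPairing_eq_integral,
    ← integral_indicator hs]
  refine integral_congr_ae ?_
  filter_upwards [indicatorConstLp_coeFn (p := q) (hs := hs) (hμs := hμs.ne) (c := (1 : ℂ))]
    with x hx
  by_cases h : x ∈ s <;> simp [hx, h]

/-- The Bochner integral of translates is the convolution. -/
lemma coeFn_integral_smul_translate (hp' : p ≠ ⊤) {k : ℝ → ℂ} (hk : Integrable k) (f : LpR p) :
    (∫ t, k t • translate t f : LpR p) =ᵐ[volume] fun x => ∫ t, k t * f (x - t) := by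
  refine ae_eq_of_forall_setIntegral_eq_of_sigmaFinite
    (fun s _ hμs => have : IsFiniteMeasure (volume.restrict s) := ⟨by simpa⟩
      ((Lp.memLp _).restrict s).integrable Fact.out)
    (fun s _ hμs => (integrable_prod_mul_translate hk f hμs).integral_prod_left)
    fun s hs hμs => ?_
  obtain ⟨L, hL⟩ := exists_setIntegral_clm (p := p) hs hμs
  rw [← hL, ← L.integral_comp_comm (integrable_smul_translate hp' hk f),
    integral_integral_swap (integrable_prod_mul_translate hk f hμs)]
  refine integral_congr_ae (ae_of_all _ fun t => ?_)
  simp only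
  rw [L.map_smul, hL, smul_eq_mul, integral_const_mul]
  congr 1
  exact integral_congr_ae (ae_restrict_of_ae (coeFn_translate t f))

/-- Convolution is commutative. -/
lemma integral_smul_translate_comm (hp' : p ≠ ⊤) {k : ℝ → ℂ} (hk : Integrable k) (f : LpR p) :
    (∫ t, k t • translate t f : LpR p) =ᵐ[volume] fun x => ∫ t, f t * k (x - t) := by
  filter_upwards [coeFn_integral_smul_translate hp' hk f] with x hx
  rw [hx, ← integral_sub_left_eq_self (fun t => f t * k (x - t)) volume x]
  simp [mul_comm]

/-- The Poisson kernel of the upper half-plane. -/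
def poisson (ε : ℝ) (x : ℝ) : ℂ := ((Real.pi⁻¹ * (ε⁻¹ * (1 + (ε⁻¹ * x) ^ 2)⁻¹) : ℝ) : ℂ)

lemma integrable_poisson {ε : ℝ} (hε : 0 < ε) : Integrable (poisson ε) :=
  (((integrable_inv_one_add_sq.comp_mul_left' (inv_ne_zero hε.ne')).const_mul ε⁻¹).const_mul
    Real.pi⁻¹).ofReal

lemma tendsto_integral_poisson_smul_translate (hp' : p ≠ ⊤) (f : LpR p) :
    Tendsto (fun n : ℕ => ∫ t, poisson (1 / ((n : ℝ) + 1)) t • translate t f) atTop (𝓝 f) := by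
  have hcv : ∀ n : ℕ, ∫ t, poisson (1 / ((n : ℝ) + 1)) t • translate t f =
      ∫ t, poisson 1 t • translate (1 / ((n : ℝ) + 1) * t) f := by
    intro n
    have hε : 0 < 1 / ((n : ℝ) + 1) := by positivity
    set ε := 1 / ((n : ℝ) + 1)
    have h := Measure.integral_comp_mul_left
      (fun t => poisson 1 t • translate (ε * t) f) ε⁻¹
    simp only [inv_inv, abs_of_pos hε] at h
    rw [← inv_smul_smul₀ hε.ne' (∫ t, poisson 1 t • translate (ε * t) f), ← h, ← integral_smul]
    refine integral_congr_ae (ae_of_all _ fun t => ?_)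
    simp only [poisson]
    rw [mul_inv_cancel_left₀ hε.ne', ← smul_assoc]
    congr 1
    simp
    ring
  simp_rw [hcv]
  have hint : ∫ t, poisson 1 t • f = f := by
    rw [integral_smul_const]
    have : ∫ t, poisson 1 t = 1 := by
      simp only [poisson]
      rw [integral_complex_ofReal, integral_const_mul]
      simp [integral_univ_inv_one_add_sq]
    rw [this, one_smul]
  conv in 𝓝 f => rw [← hint]
  refine tendsto_integral_of_dominated_convergence (fun t => ‖poisson 1 t‖ * ‖f‖) (fun n => ?_)
    ((integrable_poisson one_pos).norm.mul_const _) (fun n => ae_of_all _ fun t => ?_)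
    (ae_of_all _ fun t => ?_)
  · exact (integrable_poisson one_pos).1.smul
      ((continuous_translate hp' f).comp (continuous_const_mul _)).aestronglyMeasurable
  · rw [norm_smul, norm_translate]
  · refine tendsto_const_nhds.smul ?_
    have h := ((continuous_translate hp' f).tendsto 0).comp
      (by simpa using tendsto_one_div_add_atTop_nhds_zero_nat.mul_const t :
        Tendsto (fun n : ℕ => 1 / ((n : ℝ) + 1) * t) atTop (𝓝 0))
    simpa [Function.comp_def] using h

end Translation

section Hardy

variable {p : ℝ≥0∞}

lemma tendsto_eLpNorm_mul_zero (hp : p ≠ 0) (hp' : p ≠ ⊤) {f : ℝ → ℂ} (hf : MemLp f p)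
    {φ : ℕ → ℝ → ℂ} (hφ : ∀ n, AEStronglyMeasurable (φ n)) (hb : ∀ n x, ‖φ n x‖ ≤ 1)
    (hlim : ∀ x, Tendsto (fun n => φ n x) atTop (𝓝 0)) :
    Tendsto (fun n => eLpNorm (fun x => φ n x * f x) p) atTop (𝓝 0) := by
  have hpos : 0 < p.toReal := ENNReal.toReal_pos hp hp'
  simp_rw [eLpNorm_eq_lintegral_rpow_enorm_toReal hp hp']
  have key : Tendsto (fun n => ∫⁻ x, ‖φ n x * f x‖ₑ ^ p.toReal) atTop (𝓝 0) := by
    have h := tendsto_lintegral_of_dominated_convergence' (μ := volume)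
      (F := fun n x => ‖φ n x * f x‖ₑ ^ p.toReal) (f := fun _ => 0)
      (fun x => ‖f x‖ₑ ^ p.toReal)
      (fun n => ((hφ n).mul hf.1).enorm.pow_const _) (fun n => ae_of_all _ fun x => ?_)
      (lintegral_rpow_enorm_lt_top_of_eLpNorm_lt_top hp hp' hf.2).ne
      (ae_of_all _ fun x => ?_)
    · simpa using h
    · simp only
      gcongr
      rw [enorm_le_iff_norm_le, norm_mul]
      exact mul_le_of_le_one_left (norm_nonneg _) (hb n x)
    · have h1 : Tendsto (fun n => φ n x * f x) atTop (𝓝 0) := by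
        simpa using (hlim x).mul_const (f x)
      have h2 := ((ENNReal.continuous_rpow_const (y := p.toReal)).tendsto 0).comp
        (by simpa using h1.enorm : Tendsto (fun n => ‖φ n x * f x‖ₑ) atTop (𝓝 0))
      simpa [Function.comp_def, ENNReal.zero_rpow_of_pos hpos] using h2
  have h := ((ENNReal.continuous_rpow_const (y := 1 / p.toReal)).tendsto 0).comp key
  rwa [ENNReal.zero_rpow_of_pos (by positivity)] at h

lemma one_lt_conjExponent (hp' : p ≠ ⊤) : 1 < p.conjExponent :=
  ENNReal.lt_add_right ENNReal.one_ne_top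
    (ENNReal.inv_ne_zero.2 (ENNReal.sub_ne_top hp'))

lemma conjExponent_ne_top (hp : 1 < p) : p.conjExponent ≠ ⊤ :=
  ENNReal.add_ne_top.2 ⟨ENNReal.one_ne_top, ENNReal.inv_ne_top.2 (tsub_pos_of_lt hp).ne'⟩

lemma translate_kernel (hp : 1 < p) (hp' : p ≠ ⊤) {u : ℂ} (hu : 0 < u.im) (t : ℝ) :
    ∃ hu' : 0 < (u - t).im, translate t (memLp_kernel hu hp hp').toLp =
      (memLp_kernel hu' hp hp').toLp := by
  have hu' : 0 < (u - t).im := by simpa using hu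
  refine ⟨hu', Lp.ext ?_⟩
  filter_upwards [coeFn_translate t (memLp_kernel hu hp hp').toLp,
    (memLp_kernel hu' hp hp').coeFn_toLp,
    (measurePreserving_sub_right volume t).quasiMeasurePreserving.ae
      (memLp_kernel hu hp hp').coeFn_toLp] with x h1 h2 h3
  rw [h1, h2, h3, kernel, kernel]
  push_cast
  ring_nf

variable [Fact (1 ≤ p)]

/-- A closed subspace contains `f` as soon as it contains its regularizations
`b_{iR} f` for large `R`, because `iR b_{iR} f → f` as `R → ∞`. -/
lemma mem_of_forall_kernel_mul_mem (hp' : p ≠ ⊤) {S : Submodule ℂ (LpR p)}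
    (hS : IsClosed (S : Set (LpR p))) (f : LpR p)
    (h : ∀ R : ℝ, 0 < R → ∃ g ∈ S, g =ᵐ[volume] fun x => kernel (R * I) x * f x) : f ∈ S := by
  have hR : ∀ n : ℕ, 0 < (n : ℝ) + 1 := fun n => by positivity
  have him : ∀ n : ℕ, 0 < ((((n : ℝ) + 1 : ℝ) : ℂ) * I).im := fun n => by simpa using hR n
  choose g hgS hg using fun n : ℕ => h _ (hR n)
  let c : ℕ → ℂ := fun n => (((n : ℝ) + 1 : ℝ) : ℂ) * I
  refine hS.mem_of_tendsto (f := fun n => c n • g n) (b := atTop) ?_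
    (Eventually.of_forall fun n => S.smul_mem _ (hgS n))
  rw [Lp.tendsto_Lp_iff_tendsto_eLpNorm']
  have key := tendsto_eLpNorm_mul_zero (zero_lt_one.trans_le (Fact.out : 1 ≤ p)).ne' hp'
    (Lp.memLp f) (φ := fun n x => -(x : ℂ) * kernel (c n) x)
    (fun n => ((by fun_prop : Continuous fun x : ℝ => -(x : ℂ)).mul
      (continuous_kernel (him n))).aestronglyMeasurable) (fun n x => ?_) (fun x => ?_)
  · refine key.congr fun n => eLpNorm_congr_ae ?_
    filter_upwards [Lp.coeFn_smul (c n) (g n), hg n] with x h2 h3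
    have h0 := add_ne_zero_of_im_pos (him n) x
    rw [Pi.sub_apply, h2, Pi.smul_apply, h3, smul_eq_mul]
    change _ = c n * (kernel (c n) x * f x) - f x
    change (x : ℂ) + c n ≠ 0 at h0
    simp only [kernel]
    field_simp
    ring
  · rw [kernel, mul_one_div, norm_div, norm_neg]
    refine div_le_one_of_le₀ ?_ (norm_nonneg _)
    simpa [c] using Complex.abs_re_le_norm ((x : ℂ) + c n)
  · have hc : Tendsto (fun n => (x : ℂ) + c n) atTop (Bornology.cobounded ℂ) := by
      rw [← tendsto_norm_atTop_iff_cobounded]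
      refine tendsto_atTop_mono (fun n => ?_)
        (tendsto_atTop_add_const_right atTop (1 : ℝ) tendsto_natCast_atTop_atTop)
      simpa [c] using (Complex.im_le_norm ((x : ℂ) + c n))
    simpa [kernel] using (tendsto_inv₀_cobounded.comp hc).const_mul (-(x : ℂ))

/-- Integration against `b_u` is a continuous linear functional on `L^p(ℝ)`. -/
lemma exists_kernel_clm (hp : 1 < p) (hp' : p ≠ ⊤) {u : ℂ} (hu : 0 < u.im) :
    ∃ L : LpR p →L[ℂ] ℂ, ∀ f : LpR p, L f = ∫ x : ℝ, f x / ((x : ℂ) + u) := by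
  have : Fact (1 ≤ p.conjExponent) := ⟨(one_lt_conjExponent hp').le⟩
  have hm := memLp_kernel hu (one_lt_conjExponent hp') (conjExponent_ne_top hp)
  refine ⟨((ContinuousLinearMap.mul ℂ ℂ).lpPairing volume p p.conjExponent).flip hm.toLp,
    fun f => ?_⟩
  rw [ContinuousLinearMap.flip_apply, ContinuousLinearMap.lpPairing_eq_integral]
  refine integral_congr_ae ?_
  filter_upwards [hm.coeFn_toLp] with x hx
  rw [hx, ContinuousLinearMap.mul_apply', kernel, mul_one_div]

lemma integrable_kernel_mul_Lp (hp : 1 < p) (hp' : p ≠ ⊤) {u : ℂ} (hu : 0 < u.im) (f : LpR p) :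
    Integrable fun x => kernel u x * f x :=
  ((Lp.memLp f).integrable_mul
    (memLp_kernel hu (one_lt_conjExponent hp') (conjExponent_ne_top hp))).congr
    (ae_of_all _ fun _ => mul_comm _ _)

/-- The linear span of the products `b_u b_w`. -/
abbrev productSpan (p : ℝ≥0∞) [Fact (1 ≤ p)] : Submodule ℂ (LpR p) :=
  Submodule.span ℂ {f : LpR p | ∃ u w : ℂ, 0 < u.im ∧ 0 < w.im ∧
    (f : ℝ → ℂ) =ᵐ[volume] fun x => (1 / ((x : ℂ) + u)) * (1 / ((x : ℂ) + w))}

lemma productSpan_closure_subset_hardy (hp : 1 < p) (hp' : p ≠ ⊤) :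
    ((productSpan p).topologicalClosure : Set (LpR p)) ⊆ hardy p := by
  intro f hf u hu
  obtain ⟨L, hL⟩ := exists_kernel_clm hp hp' hu
  rw [← hL]
  refine (Submodule.topologicalClosure_minimal (t := LinearMap.ker L.toLinearMap) (productSpan p)
    (Submodule.span_le.2 ?_) L.isClosed_ker) hf
  rintro g ⟨v, w, hv, hw, hg⟩
  change L g = 0
  rw [hL, ← integral_kernel_mul_mul hu hv hw]
  refine integral_congr_ae ?_
  filter_upwards [hg] with x hx
  rw [hx]
  simp only [kernel]
  ring

lemma kernel_toLp_mem (hp : 1 < p) (hp' : p ≠ ⊤) {u : ℂ} (hu : 0 < u.im) :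
    (memLp_kernel hu hp hp').toLp ∈ (productSpan p).topologicalClosure := by
  refine mem_of_forall_kernel_mul_mem hp' (Submodule.isClosed_topologicalClosure _) _ fun R hR => ?_
  have hR' : 0 < ((R : ℂ) * I).im := by simpa using hR
  have hm : MemLp (fun x => kernel (R * I) x * kernel u x) p :=
    (memLp_kernel hu hp hp').of_le_mul
      ((continuous_kernel hR').mul (continuous_kernel hu)).aestronglyMeasurable
      (ae_of_all _ fun x => by
        rw [norm_mul]
        exact mul_le_mul_of_nonneg_right (norm_kernel_le_inv hR' x) (norm_nonneg _))
  refine ⟨hm.toLp, Submodule.le_topologicalClosure _ (Submodule.subset_span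
    ⟨R * I, u, hR', hu, hm.coeFn_toLp⟩), ?_⟩
  filter_upwards [hm.coeFn_toLp, (memLp_kernel hu hp hp').coeFn_toLp] with x h1 h2
  rw [h1, h2]

lemma poisson_sub_eq {ε : ℝ} (hε : 0 < ε) (x t : ℝ) :
    poisson ε (x - t) =
      -(2 * Real.pi * I)⁻¹ * (kernel (ε * I - x) t + kernel (ε * I) (x - t)) := by
  have him : 0 < ((ε : ℂ) * I).im := by simpa using hε
  have h1 := add_ne_zero_of_im_pos him (t - x)
  have h2 := add_ne_zero_of_im_pos him (x - t)
  have h3 : (ε : ℂ) ^ 2 + (x - t) ^ 2 ≠ 0 := by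
    have : 0 < ε ^ 2 + (x - t) ^ 2 := by positivity
    exact_mod_cast this.ne'
  have h4 : (t : ℂ) + (ε * I - x) ≠ 0 := by
    convert h1 using 1
    push_cast
    ring
  have h5 : (ε : ℂ) ≠ 0 := by exact_mod_cast hε.ne'
  have h6 : (Real.pi : ℂ) ≠ 0 := by exact_mod_cast Real.pi_ne_zero
  push_cast at h2
  have hsum : kernel (ε * I - x) t + kernel (ε * I) (x - t) =
      -(2 * I * ε) / ((ε : ℂ) ^ 2 + (x - t) ^ 2) := by
    simp only [kernel]
    push_cast
    rw [div_add_div _ _ h4 h2, div_eq_div_iff (mul_ne_zero h4 h2) h3]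
    ring_nf
    simp only [I_pow_three]
    ring
  rw [hsum, poisson]
  push_cast
  have h7 : (1 : ℂ) + ((ε : ℂ)⁻¹ * (x - t)) ^ 2 = (ε ^ 2 + (x - t) ^ 2) / ε ^ 2 := by
    field_simp
  rw [h7]
  field_simp [I_ne_zero]

/-- Multiplication by `b_u` preserves the orthogonality to `b_v` which defines the Hardy space,
for `v ≠ u`. -/
lemma integral_kernel_mul_mul_hardy (hp : 1 < p) (hp' : p ≠ ⊤) {f : LpR p} (hf : f ∈ hardy p)
    {u v : ℂ} (hu : 0 < u.im) (hv : 0 < v.im) (huv : u ≠ v) :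
    ∫ x, kernel u x * f x * kernel v x = 0 := by
  have h0 : ∀ {w : ℂ}, 0 < w.im → ∫ x, kernel w x * f x = 0 := fun {w} hw => by
    rw [← hf w hw]
    exact integral_congr_ae (ae_of_all _ fun x => by simp only [kernel]; ring)
  have h1 : ∀ x, kernel u x * f x * kernel v x =
      (v - u)⁻¹ * (kernel u x * f x - kernel v x * f x) := by
    intro x
    rw [← sub_mul, kernel_sub_kernel hu hv]
    have := sub_ne_zero.2 huv.symm
    field_simp
  simp_rw [h1]
  rw [integral_const_mul, integral_sub (integrable_kernel_mul_Lp hp hp' hu f)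
    (integrable_kernel_mul_Lp hp hp' hv f), h0 hu, h0 hv]
  simp

lemma integral_mem_of_isClosed {E : Type*} [NormedAddCommGroup E] [NormedSpace ℂ E]
    [CompleteSpace E] {S : Submodule ℂ E} (hS : IsClosed (S : Set E)) {F : ℝ → E}
    (hF : ∀ t, F t ∈ S) : ∫ t, F t ∈ S := by
  have : CompleteSpace S := hS.completeSpace_coe
  have h := S.subtypeₗᵢ.integral_comp_comm (μ := volume) fun t => (⟨F t, hF t⟩ : S)
  simp only [Submodule.coe_subtypeₗᵢ, Submodule.subtype_apply] at h
  rw [h]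
  exact Subtype.mem _

/-- For `f` in the Hardy space, the Poisson integral of `h = b_{iR} f` is a Cauchy integral, hence
a superposition of functions `b_u`. -/
lemma poisson_smul_translate_mem (hp : 1 < p) (hp' : p ≠ ⊤) {f h : LpR p} (hf : f ∈ hardy p)
    {R : ℝ} (hR : 0 < R) (hh : h =ᵐ[volume] fun x => kernel (R * I) x * f x)
    {ε : ℝ} (hε : 0 < ε) :
    ∫ t, poisson ε t • translate t h ∈ (productSpan p).topologicalClosure := by
  have hR' : 0 < ((R : ℂ) * I).im := by simpa using hR
  have hε' : 0 < ((ε : ℂ) * I).im := by simpa using hε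
  set k : ℝ → ℂ := fun x => kernel (R * I) x * f x
  have hki : Integrable k := integrable_kernel_mul_Lp hp hp' hR' f
  set B : LpR p := (memLp_kernel hε' hp hp').toLp with hB
  have hmem : ∫ t, k t • translate t B ∈ (productSpan p).topologicalClosure := by
    refine integral_mem_of_isClosed (Submodule.isClosed_topologicalClosure _) fun t =>
      Submodule.smul_mem _ _ ?_
    obtain ⟨hu, ht⟩ := translate_kernel hp hp' hε' t
    rw [hB, ht]
    exact kernel_toLp_mem hp hp' hu
  suffices ∫ t, poisson ε t • translate t h =
      -(2 * Real.pi * I : ℂ)⁻¹ • ∫ t, k t • translate t B by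
    rw [this]
    exact Submodule.smul_mem _ _ hmem
  refine Lp.ext ?_
  have hne : ∀ᵐ x : ℝ, x ≠ 0 := by simp [ae_iff]
  filter_upwards [integral_smul_translate_comm hp' (integrable_poisson hε) h,
    coeFn_integral_smul_translate hp' hki B,
    Lp.coeFn_smul (-(2 * Real.pi * I : ℂ)⁻¹) (∫ t, k t • translate t B), hne] with x h1 h2 h3 hx
  have hv : 0 < ((ε : ℂ) * I - x).im := by simpa using hε
  have hbdd : ∀ {w : ℝ → ℂ}, Continuous w → (∀ t, ‖w t‖ ≤ ε⁻¹) → Integrable fun t => k t * w t :=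
    fun hw hb => hki.mul_bdd hw.aestronglyMeasurable (ae_of_all _ hb)
  have hi1 : Integrable fun t => k t * kernel (ε * I - x) t :=
    hbdd (continuous_kernel hv) fun t => by simpa using norm_kernel_le_inv hv t
  have hi2 : Integrable fun t => k t * kernel (ε * I) (x - t) :=
    hbdd ((continuous_kernel hε').comp (continuous_const.sub continuous_id)) fun t => by
      simpa using norm_kernel_le_inv hε' (x - t)
  have h4 : ∫ t, h t * poisson ε (x - t) =
      -(2 * Real.pi * I : ℂ)⁻¹ *
        ∫ t, (k t * kernel (ε * I - x) t + k t * kernel (ε * I) (x - t)) := by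
    rw [← integral_const_mul]
    refine integral_congr_ae ?_
    filter_upwards [hh] with t ht
    rw [ht, poisson_sub_eq hε]
    ring
  have h5 : ∫ t, k t * kernel (ε * I - x) t = 0 := by
    refine integral_kernel_mul_mul_hardy hp hp' hf hR' hv fun h => hx ?_
    simpa using congrArg Complex.re h
  rw [h1, h3, Pi.smul_apply, h2, h4, integral_add hi1 hi2, h5, zero_add, smul_eq_mul]
  congr 1
  refine integral_congr_ae ?_
  filter_upwards [(quasiMeasurePreserving_sub_left volume x).ae
    (memLp_kernel hε' hp hp').coeFn_toLp] with t ht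
  exact congrArg (k t * ·) ht.symm

lemma hardy_subset_productSpan_closure (hp : 1 < p) (hp' : p ≠ ⊤) :
    hardy p ⊆ ((productSpan p).topologicalClosure : Set (LpR p)) := by
  intro f hf
  refine mem_of_forall_kernel_mul_mem hp' (Submodule.isClosed_topologicalClosure _) f
    fun R hR => ?_
  have hR' : 0 < ((R : ℂ) * I).im := by simpa using hR
  have hm : MemLp (fun x => kernel (R * I) x * f x) p :=
    (Lp.memLp f).of_le_mul
      ((continuous_kernel hR').aestronglyMeasurable.mul (Lp.memLp f).1)
      (ae_of_all _ fun x => by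
        rw [norm_mul]
        exact mul_le_mul_of_nonneg_right (norm_kernel_le_inv hR' x) (norm_nonneg _))
  refine ⟨hm.toLp, ?_, hm.coeFn_toLp⟩
  exact (Submodule.isClosed_topologicalClosure _).mem_of_tendsto
    (tendsto_integral_poisson_smul_translate hp' _)
    (Eventually.of_forall fun n =>
      poisson_smul_translate_mem hp hp' hf hR hm.coeFn_toLp (by positivity))

end Hardy

end HardySpan

/-- For every `p ∈ (1,∞)`, the linear span of
`{b_u·b_w : u, w ∈ ℍ⁺}` is dense in `H^p(ℝ)`. -/
theorem span_bu_bw_dense_in_hardy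
    (p : ℝ≥0∞) [Fact (1 ≤ p)] (hp : 1 < p) (hp' : p ≠ ⊤) :
    closure ((Submodule.span ℂ {f : LpR p | ∃ u w : ℂ, 0 < u.im ∧ 0 < w.im ∧
        (f : ℝ → ℂ) =ᵐ[volume] fun x => (1 / ((x : ℂ) + u)) * (1 / ((x : ℂ) + w))} :
      Submodule ℂ (LpR p)) : Set (LpR p)) = hardy p := by
  exact (HardySpan.productSpan_closure_subset_hardy hp hp').antisymm
    (HardySpan.hardy_subset_productSpan_closure hp hp')

end
end
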